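/- For every α ∈ [0,1] and every non-zero finite Borel measure ν on ℝ with compact support not containing 0, there exists a Borel probability measure μ on ℝ with supp(μ) ⊆ [1,2], dim_H(μ) = dim_F(μ) = α, and dim_F(μ·ν) ≥ min{1, dim_F(μ) + dim_F(ν)}, where μ·ν is the multiplicative convolution defined by ∫ f d(μ·ν) = ∫∫ f(ry) dμ(r) dν(y). -/

import Mathlib

open MeasureTheory
open scoped ENNReal

/-- Fourier transform of a measure on `ℝ`. -/
noncomputable def ft1 (μ : Measure ℝ) (ξ : ℝ) : ℂ :=
  ∫ x, Complex.exp (((-2 * Real.pi * x * ξ : ℝ) : ℂ) * Complex.I) ∂μ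

/-- Fourier dimension of a measure on `ℝ`. -/
noncomputable def fDimM1 (μ : Measure ℝ) : ℝ :=
  sSup {s : ℝ | 0 ≤ s ∧ s ≤ 1 ∧ ∃ C : ℝ, ∀ ξ, ‖ft1 μ ξ‖ ^ 2 * |ξ| ^ s ≤ C}

/-- Hausdorff dimension of a measure on `ℝ`. -/
noncomputable def hDimM (μ : Measure ℝ) : ℝ≥0∞ :=
  ⨅ (A : Set ℝ) (_ : MeasurableSet A) (_ : μ A ≠ 0), dimH A

/-- The multiplicative convolution `μ · ν`. -/
noncomputable def mulConv1 (μ ν : Measure ℝ) : Measure ℝ :=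
  (μ.prod ν).map (fun p => p.1 * p.2)

/-- The sign `±1` attached to a bit. -/
def boolSign (b : Bool) : ℝ := if b then -1 else 1

lemma sum_exp_boolSign_le {κ : Type*} [Fintype κ] [DecidableEq κ] (x : κ → ℝ) :
    ∑ ε : κ → Bool, Real.exp (∑ k, boolSign (ε k) * x k)
      ≤ 2 ^ Fintype.card κ * Real.exp ((∑ k, x k ^ 2) / 2) := by
  have h : ∑ ε : κ → Bool, Real.exp (∑ k, boolSign (ε k) * x k)
      = ∏ k, (2 * Real.cosh (x k)) := by
    have h1 := Finset.prod_univ_sum (fun _ : κ => (Finset.univ : Finset Bool))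
      (fun k b => Real.exp (boolSign b * x k))
    rw [Fintype.piFinset_univ] at h1
    simp_rw [Real.exp_sum]
    rw [← h1]
    refine Finset.prod_congr rfl fun k _ => ?_
    simp only [Fintype.sum_bool, boolSign, Real.cosh_eq]
    simp
    ring
  rw [h, Finset.prod_mul_distrib, Finset.prod_const, Finset.card_univ, Finset.sum_div,
    Real.exp_sum]
  gcongr with k _
  exact Real.cosh_le_exp_half_sq _

/-- Simultaneous sub-Gaussian choice of signs for a countable (weighted) family of vectors. -/
theorem exists_signs {ι κ : Type*} [Fintype κ] (w : ι → ℝ) (hw : ∀ i, 0 < w i)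
    (hs : Summable w) (v : ι → κ → ℝ) :
    ∃ ε : κ → Bool, ∀ i, |∑ k, boolSign (ε k) * v i k|
      ≤ Real.log (4 * (∑' i, w i) / w i) * √(∑ k, v i k ^ 2) := by
  classical
  set W := ∑' i, w i with hW
  set x : ι → κ → ℝ := fun i k => v i k / √(∑ k, v i k ^ 2) with hx
  have hxsq : ∀ i, ∑ k, x i k ^ 2 ≤ 1 := by
    intro i
    simp only [hx, div_pow]
    rw [← Finset.sum_div, Real.sq_sqrt (Finset.sum_nonneg fun _ _ => sq_nonneg _)]
    exact div_self_le_one _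
  set S : ι → (κ → Bool) → ℝ := fun i ε => ∑ k, boolSign (ε k) * x i k with hS
  have hhalf : Real.exp (1 / 2) ≤ 2 := by
    have h1 : Real.exp (1 / 2) * Real.exp (1 / 2) = Real.exp 1 := by
      rw [← Real.exp_add]; norm_num
    nlinarith [Real.exp_one_lt_d9, Real.exp_pos (1 / 2)]
  have hcard : ∀ i, ∑ ε : κ → Bool, (Real.exp (S i ε) + Real.exp (-S i ε))
      ≤ 2 ^ Fintype.card κ * 4 := by
    intro i
    rw [Finset.sum_add_distrib]
    have h1 := sum_exp_boolSign_le (x i)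
    have h2 := sum_exp_boolSign_le (fun k => -x i k)
    simp only [mul_neg, Finset.sum_neg_distrib, neg_sq] at h2
    have h3 : Real.exp ((∑ k, x i k ^ 2) / 2) ≤ 2 :=
      le_trans (Real.exp_le_exp.2 (by linarith [hxsq i])) hhalf
    have h4 : (0 : ℝ) < 2 ^ Fintype.card κ := by positivity
    simp only [hS]
    nlinarith
  have key : ∃ ε : κ → Bool, ∀ i, w i * (Real.exp (S i ε) + Real.exp (-S i ε)) ≤ 4 * W := by
    by_contra! hcon
    choose I hI using hcon
    set J := Finset.univ.image I with hJ
    have h1 : ∑ _ε : κ → Bool, 4 * W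
        < ∑ ε : κ → Bool, ∑ i ∈ J, w i * (Real.exp (S i ε) + Real.exp (-S i ε)) := by
      refine Finset.sum_lt_sum_of_nonempty Finset.univ_nonempty fun ε _ => ?_
      refine lt_of_lt_of_le (hI ε) ?_
      refine Finset.single_le_sum
        (f := fun i => w i * (Real.exp (S i ε) + Real.exp (-S i ε))) (fun i _ => ?_)
        (Finset.mem_image_of_mem I (Finset.mem_univ ε))
      have := hw i
      positivity
    rw [Finset.sum_comm] at h1
    simp_rw [← Finset.mul_sum] at h1
    have h2 : ∑ i ∈ J, w i * ∑ ε : κ → Bool, (Real.exp (S i ε) + Real.exp (-S i ε))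
        ≤ ∑ i ∈ J, w i * (2 ^ Fintype.card κ * 4) :=
      Finset.sum_le_sum fun i _ => mul_le_mul_of_nonneg_left (hcard i) (hw i).le
    rw [← Finset.sum_mul] at h2
    have h3 : ∑ i ∈ J, w i ≤ W := hs.sum_le_tsum J fun i _ => (hw i).le
    simp only [Finset.sum_const, Finset.card_univ, Fintype.card_fun, Fintype.card_bool,
      nsmul_eq_mul] at h1
    push_cast at h1
    have h4 : (0 : ℝ) < 2 ^ Fintype.card κ := by positivity
    nlinarith
  obtain ⟨ε, hε⟩ := key
  refine ⟨ε, fun i => ?_⟩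
  have hexp : Real.exp |S i ε| ≤ 4 * W / w i := by
    rw [le_div_iff₀ (hw i), mul_comm]
    refine le_trans (mul_le_mul_of_nonneg_left ?_ (hw i).le) (hε i)
    rcases abs_cases (S i ε) with h | h <;> rw [h.1] <;>
      linarith [Real.exp_pos (S i ε), Real.exp_pos (-S i ε)]
  have hlog : |S i ε| ≤ Real.log (4 * W / w i) :=
    (Real.le_log_iff_exp_le (lt_of_lt_of_le (Real.exp_pos _) hexp)).2 hexp
  have hSv : ∑ k, boolSign (ε k) * v i k = S i ε * √(∑ k, v i k ^ 2) := by
    rcases eq_or_ne (√(∑ k, v i k ^ 2)) 0 with h0 | h0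
    · rw [h0, mul_zero]
      rw [Real.sqrt_eq_zero (Finset.sum_nonneg fun _ _ => sq_nonneg _),
        Finset.sum_eq_zero_iff_of_nonneg fun _ _ => sq_nonneg _] at h0
      refine Finset.sum_eq_zero fun k hk => ?_
      rw [pow_eq_zero_iff two_ne_zero |>.1 (h0 k hk), mul_zero]
    · simp only [hS, hx, Finset.sum_mul]
      refine Finset.sum_congr rfl fun k _ => ?_
      field_simp
  rw [hSv, abs_mul, abs_of_nonneg (Real.sqrt_nonneg _)]
  exact mul_le_mul_of_nonneg_right hlog (Real.sqrt_nonneg _)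

/-- The average of `g` over the dyadic cell `[1 + p / 2 ^ j, 1 + (p + 1) / 2 ^ j]`. -/
noncomputable def cellAvg (g : ℝ → ℝ) (j p : ℕ) : ℝ :=
  2 ^ j * ∫ x in (1 + (p : ℝ) / 2 ^ j)..(1 + ((p : ℝ) + 1) / 2 ^ j), g x

/-- The mean of the averages of `g` over the first `2 ^ m` cells of level `j` listed by `a`. -/
noncomputable def treeAvg (g : ℝ → ℝ) (m j : ℕ) (a : ℕ → ℕ) : ℝ :=
  (∑ k ∈ Finset.range (2 ^ m), cellAvg g j (a k)) / 2 ^ m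

lemma cellAvg_eq {g : ℝ → ℝ} (hg : Continuous g) (j p : ℕ) :
    cellAvg g j p = (cellAvg g (j + 1) (2 * p) + cellAvg g (j + 1) (2 * p + 1)) / 2 := by
  have hi : ∀ a b : ℝ, IntervalIntegrable g volume a b := fun a b => hg.intervalIntegrable a b
  unfold cellAvg
  rw [← intervalIntegral.integral_add_adjacent_intervals
    (hi _ (1 + ((2 * p : ℕ) + 1 : ℝ) / 2 ^ (j + 1))) (hi _ _)]
  have e1 : (1 + (p : ℝ) / 2 ^ j) = 1 + ((2 * p : ℕ) : ℝ) / 2 ^ (j + 1) := by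
    push_cast; field_simp; ring
  have e2 : (1 + ((p : ℝ) + 1) / 2 ^ j) = 1 + (((2 * p + 1 : ℕ) : ℝ) + 1) / 2 ^ (j + 1) := by
    push_cast; field_simp; ring
  have e3 : (((2 * p + 1 : ℕ) : ℝ)) = ((2 * p : ℕ) : ℝ) + 1 := by push_cast; ring
  rw [e1, e2, e3]
  ring

/-- A tree of dyadic cells: `a j` lists the selected cells of level `j`; passing to the next level
one either keeps one half of each cell or keeps both. -/
structure IsDyadicTree (m : ℕ → ℕ) (a : ℕ → ℕ → ℕ) : Prop where
  m_zero : m 0 = 0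
  zero : ∀ k, a 0 k = k
  strictMono : ∀ j, StrictMono (a j)
  step : ∀ j, (m (j + 1) = m j ∧ ∀ k, a (j + 1) k / 2 = a j k) ∨
    (m (j + 1) = m j + 1 ∧ ∀ k, a (j + 1) k = 2 * a j (k / 2) + k % 2)

lemma treeAvg_double {g : ℝ → ℝ} (hg : Continuous g) (m j : ℕ) (a : ℕ → ℕ) :
    treeAvg g (m + 1) (j + 1) (fun k => 2 * a (k / 2) + k % 2) = treeAvg g m j a := by
  have key : ∀ n : ℕ, ∑ k ∈ Finset.range (2 * n), cellAvg g (j + 1) (2 * a (k / 2) + k % 2)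
      = 2 * ∑ k ∈ Finset.range n, cellAvg g j (a k) := by
    intro n
    induction n with
    | zero => simp
    | succ n ih =>
      rw [show 2 * (n + 1) = 2 * n + 1 + 1 by ring, Finset.sum_range_succ, Finset.sum_range_succ,
        Finset.sum_range_succ, ih, cellAvg_eq hg j (a n)]
      have h1 : 2 * n / 2 = n := by omega
      have h2 : 2 * n % 2 = 0 := by omega
      have h3 : (2 * n + 1) / 2 = n := by omega
      have h4 : (2 * n + 1) % 2 = 1 := by omega
      rw [h1, h2, h3, h4, add_zero]
      ring
  unfold treeAvg
  rw [pow_succ' 2 m, key, pow_succ' (2 : ℝ) m]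
  field_simp

lemma exists_half_choice {ι : Type*} (w : ι → ℝ) (hw : ∀ i, 0 < w i) (hs : Summable w)
    (g : ι → ℝ → ℝ) (hg : ∀ i, Continuous (g i)) (m j : ℕ) (a : ℕ → ℕ) (ha : StrictMono a) :
    ∃ a' : ℕ → ℕ, StrictMono a' ∧ (∀ k, a' k / 2 = a k) ∧
      ∀ i B, (∀ p, |cellAvg (g i) (j + 1) p| ≤ B) →
        |treeAvg (g i) m (j + 1) a' - treeAvg (g i) m j a|
          ≤ Real.log (4 * (∑' i, w i) / w i) * (B / √(2 ^ m)) := by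
  obtain ⟨ε, hε⟩ := exists_signs w hw hs (fun i (k : Fin (2 ^ m)) =>
    (cellAvg (g i) (j + 1) (2 * a k) - cellAvg (g i) (j + 1) (2 * a k + 1)) / 2)
  set c : ℕ → ℕ := fun k => if h : k < 2 ^ m then (if ε ⟨k, h⟩ then 1 else 0) else 0 with hc
  have hc1 : ∀ k, c k ≤ 1 := by intro k; simp only [hc]; split_ifs <;> simp
  refine ⟨fun k => 2 * a k + c k, ?_, ?_, ?_⟩
  · refine strictMono_nat_of_lt_succ fun k => ?_
    have h1 := ha (Nat.lt_succ_self k)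
    have h2 := hc1 k
    simp only [Nat.succ_eq_add_one] at h1
    change 2 * a k + c k < 2 * a (k + 1) + c (k + 1)
    omega
  · intro k
    have h2 := hc1 k
    change (2 * a k + c k) / 2 = a k
    omega
  · intro i B hB
    have hB0 : 0 ≤ B := (abs_nonneg _).trans (hB 0)
    have e : treeAvg (g i) m (j + 1) (fun k => 2 * a k + c k) - treeAvg (g i) m j a
        = (∑ k : Fin (2 ^ m), boolSign (ε k) *
          ((cellAvg (g i) (j + 1) (2 * a k) - cellAvg (g i) (j + 1) (2 * a k + 1)) / 2))
          / 2 ^ m := by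
      unfold treeAvg
      rw [← sub_div, ← Finset.sum_sub_distrib, Finset.sum_range]
      congr 1
      refine Finset.sum_congr rfl fun k _ => ?_
      rw [cellAvg_eq (hg i) j]
      have hck : c k = if ε k then 1 else 0 := by simp [hc]
      change cellAvg (g i) (j + 1) (2 * a k + c k) - _ = _
      rw [hck]
      unfold boolSign
      split_ifs
      · ring
      · rw [add_zero]; ring
    have hsq : √(∑ k : Fin (2 ^ m), ((cellAvg (g i) (j + 1) (2 * a k)
        - cellAvg (g i) (j + 1) (2 * a k + 1)) / 2) ^ 2) ≤ √(2 ^ m) * B := by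
      rw [← Real.sqrt_sq hB0, ← Real.sqrt_mul (by positivity)]
      refine Real.sqrt_le_sqrt ?_
      have : ∀ k ∈ (Finset.univ : Finset (Fin (2 ^ m))), ((cellAvg (g i) (j + 1) (2 * a k)
        - cellAvg (g i) (j + 1) (2 * a k + 1)) / 2) ^ 2 ≤ B ^ 2 := by
        intro k _
        refine sq_le_sq' ?_ ?_ <;>
          linarith [abs_le.1 (hB (2 * a k)), abs_le.1 (hB (2 * a k + 1))]
      refine (Finset.sum_le_card_nsmul _ _ _ this).trans ?_
      simp
    have hlog : 0 ≤ Real.log (4 * (∑' i, w i) / w i) := by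
      refine Real.log_nonneg ?_
      rw [le_div_iff₀ (hw i)]
      have := hs.le_tsum i fun i _ => (hw i).le
      linarith [hw i]
    have h2 : (0 : ℝ) < 2 ^ m := by positivity
    rw [e, abs_div, abs_of_pos h2, div_le_iff₀ h2]
    refine (hε i).trans ?_
    rw [mul_assoc]
    refine mul_le_mul_of_nonneg_left (hsq.trans_eq ?_) hlog
    have h3 : √((2 : ℝ) ^ m) ≠ 0 := by positivity
    have h4 := Real.mul_self_sqrt h2.le
    field_simp
    nlinarith

theorem exists_dyadicTree {ι : Type*} (w : ι → ℝ) (hw : ∀ i, 0 < w i) (hs : Summable w)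
    (g : ι → ℝ → ℝ) (hg : ∀ i, Continuous (g i)) (m : ℕ → ℕ) (hm0 : m 0 = 0)
    (hm : ∀ j, m (j + 1) = m j ∨ m (j + 1) = m j + 1) :
    ∃ a : ℕ → ℕ → ℕ, IsDyadicTree m a ∧ ∀ j i B, (∀ p, |cellAvg (g i) (j + 1) p| ≤ B) →
        |treeAvg (g i) (m (j + 1)) (j + 1) (a (j + 1)) - treeAvg (g i) (m j) j (a j)|
          ≤ Real.log (4 * (∑' i, w i) / w i) * (B / √(2 ^ m j)) := by
  have hstep : ∀ j (a : {a : ℕ → ℕ // StrictMono a}), ∃ a' : {a : ℕ → ℕ // StrictMono a},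
      ((m (j + 1) = m j ∧ ∀ k, a'.1 k / 2 = a.1 k) ∨
        (m (j + 1) = m j + 1 ∧ ∀ k, a'.1 k = 2 * a.1 (k / 2) + k % 2)) ∧
      ∀ i B, (∀ p, |cellAvg (g i) (j + 1) p| ≤ B) →
        |treeAvg (g i) (m (j + 1)) (j + 1) a'.1 - treeAvg (g i) (m j) j a.1|
          ≤ Real.log (4 * (∑' i, w i) / w i) * (B / √(2 ^ m j)) := by
    rintro j ⟨a, ha⟩
    rcases hm j with h | h
    · obtain ⟨a', h1, h2, h3⟩ := exists_half_choice w hw hs g hg (m j) j a ha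
      refine ⟨⟨a', h1⟩, Or.inl ⟨h, h2⟩, ?_⟩
      rw [h]
      exact h3
    · refine ⟨⟨fun k => 2 * a (k / 2) + k % 2, ?_⟩, Or.inr ⟨h, fun _ => rfl⟩, ?_⟩
      · refine strictMono_nat_of_lt_succ fun k => ?_
        change 2 * a (k / 2) + k % 2 < 2 * a ((k + 1) / 2) + (k + 1) % 2
        rcases Nat.even_or_odd' k with ⟨r, rfl | rfl⟩
        · rw [show 2 * r / 2 = r by omega, show (2 * r + 1) / 2 = r by omega]
          omega
        · rw [show (2 * r + 1) / 2 = r by omega, show (2 * r + 1 + 1) / 2 = r + 1 by omega]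
          have := ha (Nat.lt_succ_self r)
          simp only [Nat.succ_eq_add_one] at this
          omega
      · intro i B hB
        have hB0 : 0 ≤ B := (abs_nonneg _).trans (hB 0)
        rw [h]
        change |treeAvg (g i) (m j + 1) (j + 1) (fun k => 2 * a (k / 2) + k % 2) - _| ≤ _
        rw [treeAvg_double (hg i), sub_self, abs_zero]
        refine mul_nonneg (Real.log_nonneg ?_) (by positivity)
        rw [le_div_iff₀ (hw i)]
        have := hs.le_tsum i fun i _ => (hw i).le
        linarith [hw i]
  choose next hnext using hstep
  set b : ℕ → {a : ℕ → ℕ // StrictMono a} := fun j =>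
    Nat.rec ⟨fun k => k, strictMono_id⟩ (fun j a => next j a) j with hb
  exact ⟨fun j => (b j).1, ⟨hm0, fun k => rfl, fun j => (b j).2, fun j => (hnext j (b j)).1⟩,
    fun j => (hnext j (b j)).2⟩

/-- The index of the cell of level `j` containing the point of the tree with parameter `u`. -/
noncomputable def treePos (m : ℕ → ℕ) (a : ℕ → ℕ → ℕ) (j : ℕ) (u : ℝ) : ℕ :=
  a j ⌊u * 2 ^ m j⌋₊

/-- The point of the tree with parameter `u`. -/
noncomputable def treePoint (m : ℕ → ℕ) (a : ℕ → ℕ → ℕ) (u : ℝ) : ℝ :=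
  ⨆ j, (1 + (treePos m a j u : ℝ) / 2 ^ j)

/-- The natural probability measure on the limit set of a dyadic tree. -/
noncomputable def treeMeasure (m : ℕ → ℕ) (a : ℕ → ℕ → ℕ) : Measure ℝ :=
  (volume.restrict (Set.Ico (0 : ℝ) 1)).map (treePoint m a)

namespace IsDyadicTree

variable {m : ℕ → ℕ} {a : ℕ → ℕ → ℕ}

lemma treePos_succ_div (h : IsDyadicTree m a) (j : ℕ) (u : ℝ) :
    treePos m a (j + 1) u / 2 = treePos m a j u := by
  unfold treePos
  rcases h.step j with ⟨h1, h2⟩ | ⟨h1, h2⟩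
  · rw [h2, h1]
  · have h3 : ⌊u * 2 ^ m (j + 1)⌋₊ / 2 = ⌊u * 2 ^ m j⌋₊ := by
      rw [h1, show u * 2 ^ m j = u * 2 ^ (m j + 1) / 2 by rw [pow_succ]; ring,
        Nat.floor_div_ofNat]
    rw [h2, h3]
    omega

lemma monotone_left (h : IsDyadicTree m a) (u : ℝ) :
    Monotone fun j => 1 + (treePos m a j u : ℝ) / 2 ^ j := by
  refine monotone_nat_of_le_succ fun j => ?_
  have h1 : 2 * treePos m a j u ≤ treePos m a (j + 1) u := by
    have := h.treePos_succ_div j u; omega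
  have h2 : (2 : ℝ) * treePos m a j u ≤ treePos m a (j + 1) u := by exact_mod_cast h1
  rw [pow_succ, add_le_add_iff_left, div_le_div_iff₀ (by positivity) (by positivity)]
  nlinarith [pow_pos (two_pos : (0 : ℝ) < 2) j]

lemma antitone_right (h : IsDyadicTree m a) (u : ℝ) :
    Antitone fun j => 1 + ((treePos m a j u : ℝ) + 1) / 2 ^ j := by
  refine antitone_nat_of_succ_le fun j => ?_
  have h1 : treePos m a (j + 1) u ≤ 2 * treePos m a j u + 1 := by
    have := h.treePos_succ_div j u; omega
  have h2 : (treePos m a (j + 1) u : ℝ) ≤ 2 * treePos m a j u + 1 := by exact_mod_cast h1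
  rw [pow_succ, add_le_add_iff_left, div_le_div_iff₀ (by positivity) (by positivity)]
  nlinarith [pow_pos (two_pos : (0 : ℝ) < 2) j]

lemma left_le_right (h : IsDyadicTree m a) (u : ℝ) (i j : ℕ) :
    1 + (treePos m a i u : ℝ) / 2 ^ i ≤ 1 + ((treePos m a j u : ℝ) + 1) / 2 ^ j := by
  have h1 := h.monotone_left u (le_max_left i j)
  have h2 := h.antitone_right u (le_max_right i j)
  refine h1.trans (le_trans ?_ h2)
  simp only
  gcongr
  linarith

lemma bddAbove (h : IsDyadicTree m a) (u : ℝ) :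
    BddAbove (Set.range fun j => 1 + (treePos m a j u : ℝ) / 2 ^ j) :=
  ⟨_, by rintro _ ⟨i, rfl⟩; exact h.left_le_right u i 0⟩

lemma treePoint_mem_Icc (h : IsDyadicTree m a) (u : ℝ) (j : ℕ) :
    treePoint m a u ∈ Set.Icc (1 + (treePos m a j u : ℝ) / 2 ^ j)
      (1 + ((treePos m a j u : ℝ) + 1) / 2 ^ j) :=
  ⟨le_ciSup (h.bddAbove u) j, ciSup_le fun i => h.left_le_right u i j⟩

lemma treePoint_mem_Icc_one_two (h : IsDyadicTree m a) {u : ℝ} (hu : u ∈ Set.Ico (0 : ℝ) 1) :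
    treePoint m a u ∈ Set.Icc (1 : ℝ) 2 := by
  have h1 := h.treePoint_mem_Icc u 0
  have h2 : treePos m a 0 u = 0 := by
    simp [treePos, h.m_zero, h.zero, Nat.floor_eq_zero.2 hu.2]
  rw [h2] at h1
  norm_num at h1
  exact h1

lemma measurable_treePoint (h : IsDyadicTree m a) : Measurable (treePoint m a) := by
  refine measurable_of_tendsto_metrizable
    (f := fun j u => 1 + (treePos m a j u : ℝ) / 2 ^ j) (fun j => ?_)
    (tendsto_pi_nhds.2 fun u => tendsto_atTop_ciSup (h.monotone_left u) (h.bddAbove u))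
  have h1 : Measurable (treePos m a j) :=
    (measurable_from_nat (f := a j)).comp (Nat.measurable_floor.comp (measurable_id.mul_const _))
  exact ((measurable_from_nat (f := fun n : ℕ => (n : ℝ))).comp h1).div_const _ |>.const_add _

lemma isProbabilityMeasure (h : IsDyadicTree m a) : IsProbabilityMeasure (treeMeasure m a) := by
  have : IsProbabilityMeasure (volume.restrict (Set.Ico (0 : ℝ) 1)) := ⟨by simp⟩
  exact Measure.isProbabilityMeasure_map h.measurable_treePoint.aemeasurable

lemma ae_of_forall (h : IsDyadicTree m a) {p : ℝ → Prop} (hp : MeasurableSet {x | p x})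
    (H : ∀ u ∈ Set.Ico (0 : ℝ) 1, p (treePoint m a u)) : ∀ᵐ x ∂(treeMeasure m a), p x :=
  (ae_map_iff h.measurable_treePoint.aemeasurable hp).2
    (ae_restrict_of_forall_mem measurableSet_Ico H)

lemma ae_mem_Icc (h : IsDyadicTree m a) : ∀ᵐ x ∂(treeMeasure m a), x ∈ Set.Icc (1 : ℝ) 2 :=
  h.ae_of_forall measurableSet_Icc fun _ => h.treePoint_mem_Icc_one_two

lemma measure_le_of_ediam_le (h : IsDyadicTree m a) (j : ℕ) (A : Set ℝ)
    (hA : Metric.ediam A ≤ ENNReal.ofReal ((2 ^ j)⁻¹)) :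
    treeMeasure m a A ≤ ENNReal.ofReal (6 / 2 ^ m j) := by
  refine (measure_mono subset_closure).trans ?_
  rw [← Metric.ediam_closure] at hA
  unfold treeMeasure
  rw [Measure.map_apply h.measurable_treePoint isClosed_closure.measurableSet,
    Measure.restrict_apply (h.measurable_treePoint isClosed_closure.measurableSet)]
  rcases Set.eq_empty_or_nonempty (treePoint m a ⁻¹' closure A ∩ Set.Ico 0 1) with h0 | ⟨v, hv⟩
  · rw [h0]; simp
  have hT : (0 : ℝ) < 2 ^ m j := by positivity
  have hj : (0 : ℝ) < 2 ^ j := by positivity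
  have one_side : ∀ u v : ℝ, 0 ≤ u → 0 ≤ v → treePoint m a u ∈ closure A →
      treePoint m a v ∈ closure A → u ≤ v + 3 / 2 ^ m j := by
    intro u v hu0 hv0 hu hv
    have hd : dist (treePoint m a u) (treePoint m a v) ≤ (2 ^ j)⁻¹ := by
      have := (Metric.edist_le_ediam_of_mem hu hv).trans hA
      rwa [edist_dist, ENNReal.ofReal_le_ofReal_iff (by positivity)] at this
    have h1 := (h.treePoint_mem_Icc u j).1
    have h2 := (h.treePoint_mem_Icc v j).2
    have h3 : (treePos m a j u : ℝ) / 2 ^ j ≤ ((treePos m a j v : ℝ) + 1) / 2 ^ j + (2 ^ j)⁻¹ := by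
      rw [Real.dist_eq] at hd
      linarith [(abs_le.1 hd).2]
    have h4 : (treePos m a j u : ℝ) ≤ treePos m a j v + 2 := by
      rw [inv_eq_one_div, ← add_div, div_le_div_iff_of_pos_right hj] at h3
      linarith
    have h5 : treePos m a j u ≤ treePos m a j v + 2 := by exact_mod_cast h4
    have h6 : ⌊u * 2 ^ m j⌋₊ ≤ ⌊v * 2 ^ m j⌋₊ + 2 := by
      by_contra! hlt
      have h7 := (h.strictMono j).add_le_nat 3 ⌊v * 2 ^ m j⌋₊
      have h8 := (h.strictMono j).monotone (show 3 + ⌊v * 2 ^ m j⌋₊ ≤ ⌊u * 2 ^ m j⌋₊ by omega)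
      unfold treePos at h5
      omega
    have h9 := Nat.lt_floor_add_one (u * 2 ^ m j)
    have h10 := Nat.floor_le (show 0 ≤ v * 2 ^ m j by positivity)
    have h11 : (⌊u * 2 ^ m j⌋₊ : ℝ) ≤ ⌊v * 2 ^ m j⌋₊ + 2 := by exact_mod_cast h6
    have h12 : u * 2 ^ m j ≤ (v + 3 / 2 ^ m j) * 2 ^ m j := by
      rw [add_mul, div_mul_cancel₀ _ hT.ne']
      linarith
    exact le_of_mul_le_mul_right h12 hT
  have hsub : treePoint m a ⁻¹' closure A ∩ Set.Ico 0 1 ⊆ Metric.closedBall v (3 / 2 ^ m j) := by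
    rintro u ⟨hu, hu1⟩
    rw [Metric.mem_closedBall, Real.dist_eq, abs_le]
    have h1 := one_side u v hu1.1 hv.2.1 hu hv.1
    have h2 := one_side v u hv.2.1 hu1.1 hv.1 hu
    constructor <;> linarith
  refine (measure_mono hsub).trans ?_
  rw [Real.volume_closedBall]
  refine ENNReal.ofReal_le_ofReal (le_of_eq ?_)
  ring

lemma le_measure_closedBall (h : IsDyadicTree m a) (j : ℕ) {u : ℝ} (hu : u ∈ Set.Ico (0 : ℝ) 1) :
    ENNReal.ofReal (1 / 2 ^ m j)
      ≤ treeMeasure m a (Metric.closedBall (treePoint m a u) ((2 ^ j)⁻¹)) := by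
  unfold treeMeasure
  rw [Measure.map_apply h.measurable_treePoint Metric.isClosed_closedBall.measurableSet,
    Measure.restrict_apply (h.measurable_treePoint Metric.isClosed_closedBall.measurableSet)]
  have hT : (0 : ℝ) < 2 ^ m j := by positivity
  have hT1 : ((2 ^ m j : ℕ) : ℝ) = 2 ^ m j := by push_cast; rfl
  set k := ⌊u * 2 ^ m j⌋₊ with hk
  have hk1 : k + 1 ≤ 2 ^ m j := by
    have : k < 2 ^ m j := by
      rw [hk, Nat.floor_lt (by have := hu.1; positivity), hT1]
      nlinarith [hu.2]
    omega
  have hk2 : (k : ℝ) + 1 ≤ 2 ^ m j := by rw [← hT1]; exact_mod_cast hk1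
  have hsub : Set.Ico ((k : ℝ) / 2 ^ m j) (((k : ℝ) + 1) / 2 ^ m j)
      ⊆ treePoint m a ⁻¹' Metric.closedBall (treePoint m a u) ((2 ^ j)⁻¹) ∩ Set.Ico 0 1 := by
    rintro v ⟨hv1, hv2⟩
    have hv0 : 0 ≤ v := le_trans (by positivity) hv1
    refine ⟨?_, hv0, lt_of_lt_of_le hv2 ((div_le_one hT).2 hk2)⟩
    rw [div_le_iff₀ hT] at hv1
    rw [lt_div_iff₀ hT] at hv2
    have hfl : ⌊v * 2 ^ m j⌋₊ = k := (Nat.floor_eq_iff (by positivity)).2 ⟨hv1, hv2⟩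
    have hpos : treePos m a j v = treePos m a j u := by unfold treePos; rw [hfl]
    have h1 := h.treePoint_mem_Icc u j
    have h2 := h.treePoint_mem_Icc v j
    rw [hpos] at h2
    have h3 : ((treePos m a j u : ℝ) + 1) / 2 ^ j = (treePos m a j u : ℝ) / 2 ^ j + (2 ^ j)⁻¹ := by
      ring
    rw [h3] at h1 h2
    rw [Set.mem_preimage, Metric.mem_closedBall, Real.dist_eq, abs_le]
    constructor <;> linarith [h1.1, h1.2, h2.1, h2.2]
  refine le_trans (le_of_eq ?_) (measure_mono hsub)
  rw [Real.volume_Ico]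
  congr 1
  ring

end IsDyadicTree

lemma setIntegral_floor (f : ℕ → ℝ) (T : ℕ) (hT : 0 < T) :
    ∫ u in Set.Ico (0 : ℝ) 1, f ⌊u * T⌋₊ = (∑ k ∈ Finset.range T, f k) / T := by
  have hT' : (0 : ℝ) < T := by exact_mod_cast hT
  have hle : ∀ k : ℕ, (k : ℝ) / T ≤ ((k + 1 : ℕ) : ℝ) / T := fun k => by gcongr; simp
  have hcongr : ∀ k : ℕ, Set.EqOn (fun _ => f k) (fun u : ℝ => f ⌊u * T⌋₊)
      (Set.Ioo ((k : ℝ) / T) (((k + 1 : ℕ) : ℝ) / T)) := by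
    rintro k u ⟨h1, h2⟩
    rw [div_lt_iff₀ hT'] at h1
    rw [lt_div_iff₀ hT'] at h2
    have : ⌊u * T⌋₊ = k := by
      refine (Nat.floor_eq_iff (le_trans (by positivity) h1.le)).2 ⟨h1.le, ?_⟩
      exact_mod_cast h2
    simp only [this]
  have hint : ∀ k : ℕ, IntervalIntegrable (fun u : ℝ => f ⌊u * T⌋₊) volume
      ((k : ℝ) / T) (((k + 1 : ℕ) : ℝ) / T) := by
    intro k
    rw [intervalIntegrable_iff_integrableOn_Ioo_of_le (hle k)]
    exact IntegrableOn.congr_fun (integrableOn_const (by simp)) (hcongr k) measurableSet_Ioo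
  have hval : ∀ k : ℕ, ∫ u in ((k : ℝ) / T)..(((k + 1 : ℕ) : ℝ) / T), f ⌊u * T⌋₊ = f k / T := by
    intro k
    rw [intervalIntegral.integral_of_le (hle k), integral_Ioc_eq_integral_Ioo,
      ← setIntegral_congr_fun measurableSet_Ioo (hcongr k), ← integral_Ioc_eq_integral_Ioo,
      ← intervalIntegral.integral_of_le (hle k), intervalIntegral.integral_const, smul_eq_mul]
    push_cast
    field_simp
    ring
  have hsum := intervalIntegral.sum_integral_adjacent_intervals (n := T)
    (a := fun k : ℕ => (k : ℝ) / T) (f := fun u : ℝ => f ⌊u * T⌋₊) fun k _ => hint k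
  rw [Finset.sum_congr rfl fun k _ => hval k, ← Finset.sum_div, Nat.cast_zero, zero_div,
    div_self hT'.ne', intervalIntegral.integral_of_le zero_le_one, integral_Ioc_eq_integral_Ioo,
    ← integral_Ico_eq_integral_Ioo] at hsum
  exact hsum.symm

lemma abs_cellAvg_sub_le {g : ℝ → ℝ} (hg : Continuous g) (j p : ℕ) (c B : ℝ)
    (hB : ∀ x ∈ Set.Icc (1 + (p : ℝ) / 2 ^ j) (1 + ((p : ℝ) + 1) / 2 ^ j), |g x - c| ≤ B) :
    |cellAvg g j p - c| ≤ B := by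
  have hle : 1 + (p : ℝ) / 2 ^ j ≤ 1 + ((p : ℝ) + 1) / 2 ^ j := by gcongr; linarith
  have hj : (0 : ℝ) < 2 ^ j := by positivity
  have hlen : (1 + ((p : ℝ) + 1) / 2 ^ j) - (1 + (p : ℝ) / 2 ^ j) = (2 ^ j)⁻¹ := by ring
  have e : cellAvg g j p - c
      = 2 ^ j * ∫ x in (1 + (p : ℝ) / 2 ^ j)..(1 + ((p : ℝ) + 1) / 2 ^ j), (g x - c) := by
    rw [intervalIntegral.integral_sub (hg.intervalIntegrable _ _) (by simp),
      intervalIntegral.integral_const, hlen, smul_eq_mul, mul_sub, ← mul_assoc,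
      mul_inv_cancel₀ hj.ne', one_mul, cellAvg]
  rw [e, abs_mul, abs_of_pos hj]
  have h1 := intervalIntegral.norm_integral_le_of_norm_le_const
    (f := fun x => g x - c) (C := B) (a := 1 + (p : ℝ) / 2 ^ j)
    (b := 1 + ((p : ℝ) + 1) / 2 ^ j) (fun x hx => by
      rw [Set.uIoc_of_le hle] at hx
      exact hB x ⟨hx.1.le, hx.2⟩)
  rw [hlen, abs_of_pos (by positivity), Real.norm_eq_abs] at h1
  calc (2 : ℝ) ^ j * |∫ x in (1 + (p : ℝ) / 2 ^ j)..(1 + ((p : ℝ) + 1) / 2 ^ j), (g x - c)|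
      ≤ 2 ^ j * (B * (2 ^ j)⁻¹) := by gcongr
    _ = B := by field_simp

lemma IsDyadicTree.tendsto_treeAvg {m : ℕ → ℕ} {a : ℕ → ℕ → ℕ} (h : IsDyadicTree m a)
    {g : ℝ → ℝ} (hg : Continuous g) {M : ℝ} (hM : ∀ x, |g x| ≤ M) :
    Filter.Tendsto (fun j => treeAvg g (m j) j (a j)) Filter.atTop
      (nhds (∫ x, g x ∂(treeMeasure m a))) := by
  have e1 : ∫ x, g x ∂(treeMeasure m a) = ∫ u in Set.Ico (0 : ℝ) 1, g (treePoint m a u) :=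
    integral_map h.measurable_treePoint.aemeasurable hg.aestronglyMeasurable
  have e2 : ∀ j, treeAvg g (m j) j (a j)
      = ∫ u in Set.Ico (0 : ℝ) 1, cellAvg g j (treePos m a j u) := by
    intro j
    have := setIntegral_floor (fun k => cellAvg g j (a j k)) (2 ^ m j) (by positivity)
    push_cast at this
    exact this.symm
  simp_rw [e1, e2]
  refine tendsto_integral_of_dominated_convergence (fun _ => M) (fun j => ?_)
    (integrable_const M) (fun j => ?_) (Filter.Eventually.of_forall fun u => ?_)
  · exact ((measurable_from_nat (f := fun k => cellAvg g j (a j k))).comp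
      (Nat.measurable_floor.comp (measurable_id.mul_const _))).aestronglyMeasurable
  · refine Filter.Eventually.of_forall fun u => ?_
    have := abs_cellAvg_sub_le hg j (treePos m a j u) 0 M fun x _ => by simpa using hM x
    simpa using this
  · rw [Metric.tendsto_atTop]
    intro ε hε
    obtain ⟨δ, hδ, hδ'⟩ := Metric.continuous_iff.1 hg (treePoint m a u) (ε / 2) (half_pos hε)
    obtain ⟨N, hN⟩ := exists_pow_lt_of_lt_one hδ (show (1 / 2 : ℝ) < 1 by norm_num)
    refine ⟨N, fun j hj => ?_⟩
    rw [Real.dist_eq]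
    refine lt_of_le_of_lt (abs_cellAvg_sub_le hg j _ _ (ε / 2) fun x hx => ?_) (half_lt_self hε)
    rw [← Real.dist_eq]
    refine (hδ' x ?_).le
    have h1 := h.treePoint_mem_Icc u j
    have h2 : ((treePos m a j u : ℝ) + 1) / 2 ^ j
        = (treePos m a j u : ℝ) / 2 ^ j + (1 / 2) ^ j := by
      rw [one_div, inv_pow]; ring
    rw [h2] at h1 hx
    have h3 : (1 / 2 : ℝ) ^ j ≤ (1 / 2) ^ N :=
      pow_le_pow_of_le_one (by norm_num) (by norm_num) hj
    rw [Real.dist_eq, abs_lt]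
    constructor <;> linarith [h1.1, h1.2, hx.1, hx.2]

section Dimension

variable {m : ℕ → ℕ} {a : ℕ → ℕ → ℕ} {α : ℝ}

lemma inv_two_pow_rpow (α : ℝ) (j : ℕ) : (((2 : ℝ) ^ j)⁻¹) ^ α = 2 ^ (-(α * j)) := by
  rw [← Real.rpow_natCast, ← Real.rpow_neg two_pos.le, ← Real.rpow_mul two_pos.le]
  congr 1
  ring

lemma one_div_two_pow_le {j n : ℕ} (h : α * j ≤ n + 1) :
    1 / 2 ^ n ≤ 2 * (((2 : ℝ) ^ j)⁻¹) ^ α := by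
  rw [inv_two_pow_rpow, one_div, ← Real.rpow_natCast, ← Real.rpow_neg two_pos.le]
  nth_rw 2 [← Real.rpow_one 2]
  rw [← Real.rpow_add two_pos]
  exact Real.rpow_le_rpow_of_exponent_le one_le_two (by linarith)

lemma rpow_le_one_div_two_pow {j n : ℕ} (h : (n : ℝ) ≤ α * j) :
    (((2 : ℝ) ^ j)⁻¹) ^ α ≤ 1 / 2 ^ n := by
  rw [inv_two_pow_rpow, one_div, ← Real.rpow_natCast, ← Real.rpow_neg two_pos.le]
  exact Real.rpow_le_rpow_of_exponent_le one_le_two (by linarith)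

lemma IsDyadicTree.measure_le_ediam_rpow (h : IsDyadicTree m a) (hα : 0 < α)
    (hm : ∀ j : ℕ, α * j ≤ m j + 1) (A : Set ℝ) (hA : Metric.ediam A ≤ 1) :
    treeMeasure m a A ≤ ENNReal.ofReal (12 * 2 ^ α) * Metric.ediam A ^ α := by
  have key : ∀ j : ℕ, Metric.ediam A ≤ ENNReal.ofReal ((2 ^ j)⁻¹) →
      treeMeasure m a A ≤ ENNReal.ofReal (12 * (((2 : ℝ) ^ j)⁻¹) ^ α) := by
    intro j hj
    refine (h.measure_le_of_ediam_le j A hj).trans (ENNReal.ofReal_le_ofReal ?_)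
    have := one_div_two_pow_le (hm j)
    calc (6 : ℝ) / 2 ^ m j = 6 * (1 / 2 ^ m j) := by ring
      _ ≤ 6 * (2 * (((2 : ℝ) ^ j)⁻¹) ^ α) := by gcongr
      _ = _ := by ring
  have htop : Metric.ediam A ≠ ⊤ := ne_top_of_le_ne_top ENNReal.one_ne_top hA
  rcases eq_or_ne (Metric.ediam A) 0 with h0 | h0
  · rw [h0, ENNReal.zero_rpow_of_pos hα, mul_zero]
    have hlim : Filter.Tendsto (fun j : ℕ => ENNReal.ofReal (12 * (((2 : ℝ) ^ j)⁻¹) ^ α))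
        Filter.atTop (nhds (ENNReal.ofReal (12 * (0 : ℝ) ^ α))) := by
      refine ENNReal.tendsto_ofReal (Filter.Tendsto.const_mul _ ?_)
      refine Filter.Tendsto.rpow_const ?_ (Or.inr hα.le)
      exact tendsto_inv_atTop_zero.comp (tendsto_pow_atTop_atTop_of_one_lt one_lt_two)
    rw [Real.zero_rpow hα.ne', mul_zero, ENNReal.ofReal_zero] at hlim
    exact ge_of_tendsto' hlim fun j => key j (by rw [h0]; simp)
  · have ht0 : 0 < (Metric.ediam A).toReal := ENNReal.toReal_pos h0 htop
    have ht1 : (Metric.ediam A).toReal ≤ 1 := by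
      simpa using ENNReal.toReal_mono ENNReal.one_ne_top hA
    obtain ⟨j, hj1, hj2⟩ := exists_nat_pow_near_of_lt_one ht0 ht1
      (show (0 : ℝ) < 2⁻¹ by norm_num) (by norm_num)
    rw [inv_pow] at hj1 hj2
    refine (key j ?_).trans ?_
    · rw [← ENNReal.ofReal_toReal htop]
      exact ENNReal.ofReal_le_ofReal hj2
    · rw [← ENNReal.ofReal_toReal htop, ENNReal.ofReal_rpow_of_pos ht0,
        ← ENNReal.ofReal_mul (by positivity)]
      refine ENNReal.ofReal_le_ofReal ?_
      rw [mul_assoc, ← Real.mul_rpow two_pos.le ht0.le]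
      gcongr
      rw [pow_succ, mul_inv] at hj1
      linarith

lemma IsDyadicTree.hDimM_eq (h : IsDyadicTree m a) (hα : 0 < α)
    (hm1 : ∀ j : ℕ, (m j : ℝ) ≤ α * j) (hm2 : ∀ j : ℕ, α * j ≤ m j + 1) :
    hDimM (treeMeasure m a) = ENNReal.ofReal α := by
  have hαc : ((α.toNNReal : NNReal) : ℝ) = α := Real.coe_toNNReal _ hα.le
  refine le_antisymm ?_ ?_
  · set A : Set ℝ := ⋂ j, ⋃ k : Fin (2 ^ m j),
      Set.Icc (1 + (a j k : ℝ) / 2 ^ j) (1 + ((a j k : ℝ) + 1) / 2 ^ j) with hA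
    have hAm : MeasurableSet A :=
      MeasurableSet.iInter fun j => MeasurableSet.iUnion fun k => measurableSet_Icc
    have hA1 : treeMeasure m a A ≠ 0 := by
      have := h.isProbabilityMeasure
      have hae : ∀ᵐ x ∂(treeMeasure m a), x ∈ A := by
        refine h.ae_of_forall hAm fun u hu => Set.mem_iInter.2 fun j => Set.mem_iUnion.2 ?_
        have hk : ⌊u * 2 ^ m j⌋₊ < 2 ^ m j := by
          rw [Nat.floor_lt (by have := hu.1; positivity)]
          push_cast
          nlinarith [hu.2, pow_pos (two_pos : (0 : ℝ) < 2) (m j)]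
        exact ⟨⟨_, hk⟩, h.treePoint_mem_Icc u j⟩
      rw [(mem_ae_iff_prob_eq_one hAm).1 hae]
      exact one_ne_zero
    refine (iInf₂_le A hAm).trans ((iInf_le _ hA1).trans ?_)
    refine dimH_le_of_hausdorffMeasure_ne_top (ne_top_of_le_ne_top ENNReal.one_ne_top ?_)
    rw [hαc]
    have hediam : ∀ j (k : Fin (2 ^ m j)), Metric.ediam
        (Set.Icc (1 + (a j k : ℝ) / 2 ^ j) (1 + ((a j k : ℝ) + 1) / 2 ^ j))
        = ENNReal.ofReal ((2 ^ j)⁻¹) := by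
      intro j k
      rw [Real.ediam_Icc]
      congr 1
      ring
    refine (Measure.hausdorffMeasure_le_liminf_sum (l := Filter.atTop) α A
      (fun j : ℕ => ENNReal.ofReal ((2 ^ j)⁻¹)) ?_
      (fun j (k : Fin (2 ^ m j)) =>
        Set.Icc (1 + (a j k : ℝ) / 2 ^ j) (1 + ((a j k : ℝ) + 1) / 2 ^ j))
      (Filter.Eventually.of_forall fun j k => (hediam j k).le)
      (Filter.Eventually.of_forall fun j => Set.iInter_subset _ j)).trans ?_
    · rw [← ENNReal.ofReal_zero]
      exact ENNReal.tendsto_ofReal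
        (tendsto_inv_atTop_zero.comp (tendsto_pow_atTop_atTop_of_one_lt one_lt_two))
    · refine Filter.liminf_le_of_le (by isBoundedDefault) fun b hb => ?_
      obtain ⟨j, hj⟩ := hb.exists
      refine hj.trans ?_
      simp_rw [hediam]
      rw [Finset.sum_const, Finset.card_univ, Fintype.card_fin, nsmul_eq_mul,
        ENNReal.ofReal_rpow_of_pos (by positivity), ← ENNReal.ofReal_natCast,
        ← ENNReal.ofReal_mul (by positivity), ENNReal.ofReal_le_one]
      have := rpow_le_one_div_two_pow (hm1 j)
      rw [le_div_iff₀ (by positivity)] at this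
      push_cast
      linarith
  · refine le_iInf fun A => le_iInf fun hAm => le_iInf fun hA0 => ?_
    refine le_dimH_of_hausdorffMeasure_ne_zero ?_
    rw [hαc]
    intro hzero
    set C := ENNReal.ofReal (12 * 2 ^ α) with hC
    have hC0 : C ≠ 0 := by rw [hC, ne_eq, ENNReal.ofReal_eq_zero, not_le]; positivity
    have hCt : C ≠ ⊤ := ENNReal.ofReal_ne_top
    have hle : C⁻¹ • treeMeasure m a ≤ μH[α] := by
      refine Measure.le_hausdorffMeasure α _ 1 one_pos fun s hs => ?_
      rw [Measure.smul_apply, smul_eq_mul, mul_comm, ← div_eq_mul_inv]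
      exact ENNReal.div_le_of_le_mul' (h.measure_le_ediam_rpow hα hm2 s hs)
    have h1 := hle A
    rw [hzero, Measure.smul_apply, smul_eq_mul, nonpos_iff_eq_zero, mul_eq_zero] at h1
    rcases h1 with h1 | h1
    · exact hCt (ENNReal.inv_eq_zero.1 h1)
    · exact hA0 h1

end Dimension

section Energy

variable {μ : Measure ℝ} [IsProbabilityMeasure μ]

lemma norm_exp_ofReal_mul_I_integrand (x ξ : ℝ) :
    ‖Complex.exp (((-2 * Real.pi * x * ξ : ℝ) : ℂ) * Complex.I)‖ = 1 :=
  Complex.norm_exp_ofReal_mul_I _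

lemma norm_ft1_le (ν : Measure ℝ) [IsFiniteMeasure ν] (ξ : ℝ) : ‖ft1 ν ξ‖ ≤ ν.real Set.univ := by
  have := norm_integral_le_of_norm_le_const (μ := ν) (C := 1)
    (Filter.Eventually.of_forall fun x => (norm_exp_ofReal_mul_I_integrand x ξ).le)
  simpa [ft1] using this

lemma ofReal_norm_ft1_sq (ξ : ℝ) :
    ((‖ft1 μ ξ‖ ^ 2 : ℝ) : ℂ) = ∫ z : ℝ × ℝ,
      Complex.exp (Complex.I * ((-2 * Real.pi * (z.1 - z.2) : ℝ) : ℂ) * ξ) ∂(μ.prod μ) := by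
  rw [Complex.ofReal_pow, ← Complex.mul_conj', ft1, ← integral_conj, ← integral_prod_mul]
  refine integral_congr_ae (Filter.Eventually.of_forall fun z => ?_)
  simp only
  rw [← Complex.exp_conj, ← Complex.exp_add]
  congr 1
  simp only [map_mul, Complex.conj_ofReal, Complex.conj_I]
  push_cast
  ring

lemma integral_gaussian_mul_norm_ft1_sq {b : ℝ} (hb : 0 < b) :
    ∫ ξ : ℝ, Real.exp (-b * ξ ^ 2) * ‖ft1 μ ξ‖ ^ 2
      = ∫ x, ∫ y, √(Real.pi / b) * Real.exp (-(Real.pi * (x - y)) ^ 2 / b) ∂μ ∂μ := by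
  have hint : Integrable (Function.uncurry fun (ξ : ℝ) (z : ℝ × ℝ) =>
      Complex.exp (Complex.I * ((-2 * Real.pi * (z.1 - z.2) : ℝ) : ℂ) * ξ)
        * Complex.exp (-(b : ℂ) * (ξ : ℂ) ^ 2)) (volume.prod (μ.prod μ)) := by
    have h1 : Integrable (fun p : ℝ × (ℝ × ℝ) => Real.exp (-b * p.1 ^ 2) * (1 : ℝ))
        (volume.prod (μ.prod μ)) :=
      (integrable_exp_neg_mul_sq hb).mul_prod (integrable_const (1 : ℝ))
    refine h1.mono' (Continuous.aestronglyMeasurable ?_) (Filter.Eventually.of_forall ?_)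
    · unfold Function.uncurry
      fun_prop
    · rintro ⟨ξ, z⟩
      simp only [Function.uncurry, norm_mul, Complex.norm_exp]
      rw [mul_comm]
      refine mul_le_mul (le_of_eq ?_) (le_of_eq ?_) (Real.exp_pos _).le (Real.exp_pos _).le
      · congr 1
        norm_cast
      · simp
  have hswap := integral_integral_swap hint
  have hL : ∀ ξ : ℝ, (∫ z : ℝ × ℝ,
      Complex.exp (Complex.I * ((-2 * Real.pi * (z.1 - z.2) : ℝ) : ℂ) * ξ)
        * Complex.exp (-(b : ℂ) * (ξ : ℂ) ^ 2) ∂(μ.prod μ))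
      = ((Real.exp (-b * ξ ^ 2) * ‖ft1 μ ξ‖ ^ 2 : ℝ) : ℂ) := by
    intro ξ
    rw [integral_mul_const, ← ofReal_norm_ft1_sq, mul_comm]
    push_cast
    rfl
  have hR : ∀ z : ℝ × ℝ, (∫ ξ : ℝ,
      Complex.exp (Complex.I * ((-2 * Real.pi * (z.1 - z.2) : ℝ) : ℂ) * ξ)
        * Complex.exp (-(b : ℂ) * (ξ : ℂ) ^ 2))
      = ((√(Real.pi / b) * Real.exp (-(Real.pi * (z.1 - z.2)) ^ 2 / b) : ℝ) : ℂ) := by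
    intro z
    rw [fourierIntegral_gaussian (by simpa using hb)]
    have hsqrt : ((√(Real.pi / b) : ℝ) : ℂ) = ((Real.pi : ℂ) / b) ^ (1 / 2 : ℂ) := by
      rw [Real.sqrt_eq_rpow, Complex.ofReal_cpow (by have := Real.pi_pos; positivity)]
      push_cast
      rfl
    rw [Complex.ofReal_mul (√(Real.pi / b)), hsqrt]
    push_cast
    congr 2
    have : (b : ℂ) ≠ 0 := by exact_mod_cast hb.ne'
    field_simp
    ring
  simp_rw [hL, hR, integral_complex_ofReal] at hswap
  have hswap' := Complex.ofReal_injective hswap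
  rw [hswap', integral_prod]
  refine Integrable.mono' (integrable_const (√(Real.pi / b))) ?_ (Filter.Eventually.of_forall ?_)
  · exact Continuous.aestronglyMeasurable (by fun_prop)
  · intro z
    rw [Real.norm_eq_abs, abs_of_nonneg (by positivity)]
    refine mul_le_of_le_one_right (Real.sqrt_nonneg _) (Real.exp_le_one_iff.2 ?_)
    rw [neg_div]
    exact neg_nonpos.2 (by positivity)

lemma fourier_energy_lower {δ c : ℝ} (hδ : 0 < δ)
    (h : ∀ᵐ x ∂μ, ENNReal.ofReal c ≤ μ (Metric.closedBall x δ)) :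
    δ⁻¹ * Real.exp (-Real.pi) * c
      ≤ ∫ ξ : ℝ, Real.exp (-(Real.pi * δ ^ 2) * ξ ^ 2) * ‖ft1 μ ξ‖ ^ 2 := by
  have hpi := Real.pi_pos
  rw [integral_gaussian_mul_norm_ft1_sq (by positivity)]
  have e1 : √(Real.pi / (Real.pi * δ ^ 2)) = δ⁻¹ := by
    rw [← div_div, div_self hpi.ne', one_div, ← inv_pow, Real.sqrt_sq (by positivity)]
  rw [e1]
  have hbd : ∀ x y : ℝ, |δ⁻¹ * Real.exp (-(Real.pi * (x - y)) ^ 2 / (Real.pi * δ ^ 2))| ≤ δ⁻¹ := by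
    intro x y
    rw [abs_of_nonneg (by positivity)]
    refine mul_le_of_le_one_right (by positivity) (Real.exp_le_one_iff.2 ?_)
    rw [neg_div]
    exact neg_nonpos.2 (by positivity)
  have hinn : ∀ x : ℝ, Integrable (fun y : ℝ =>
      δ⁻¹ * Real.exp (-(Real.pi * (x - y)) ^ 2 / (Real.pi * δ ^ 2))) μ := fun x =>
    Integrable.mono' (integrable_const δ⁻¹)
      (Continuous.aestronglyMeasurable (by fun_prop)) (Filter.Eventually.of_forall (hbd x))
  have hout : Integrable (fun x : ℝ =>
      ∫ y, δ⁻¹ * Real.exp (-(Real.pi * (x - y)) ^ 2 / (Real.pi * δ ^ 2)) ∂μ) μ := by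
    have : Integrable (fun z : ℝ × ℝ =>
      δ⁻¹ * Real.exp (-(Real.pi * (z.1 - z.2)) ^ 2 / (Real.pi * δ ^ 2))) (μ.prod μ) :=
      Integrable.mono' (integrable_const δ⁻¹)
        (Continuous.aestronglyMeasurable (by fun_prop))
        (Filter.Eventually.of_forall fun z => hbd z.1 z.2)
    exact this.integral_prod_left
  have hconst : ∫ _x, δ⁻¹ * Real.exp (-Real.pi) * c ∂μ = δ⁻¹ * Real.exp (-Real.pi) * c := by simp
  rw [← hconst]
  refine integral_mono_ae (integrable_const _) hout ?_
  filter_upwards [h] with x hx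
  have hcr : c ≤ μ.real (Metric.closedBall x δ) := by
    rw [Measure.real]
    exact (ENNReal.ofReal_le_iff_le_toReal (measure_ne_top _ _)).1 hx
  have h1 : ∫ _y in Metric.closedBall x δ, δ⁻¹ * Real.exp (-Real.pi) ∂μ
      ≤ ∫ y in Metric.closedBall x δ,
        δ⁻¹ * Real.exp (-(Real.pi * (x - y)) ^ 2 / (Real.pi * δ ^ 2)) ∂μ := by
    refine setIntegral_mono_on (integrable_const _) (hinn x).integrableOn
      Metric.isClosed_closedBall.measurableSet fun y hy => ?_
    refine mul_le_mul_of_nonneg_left (Real.exp_le_exp.2 ?_) (by positivity)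
    rw [Metric.mem_closedBall, Real.dist_eq, abs_sub_comm] at hy
    have h2 : (x - y) ^ 2 ≤ δ ^ 2 := by
      rw [← sq_abs (x - y)]
      exact pow_le_pow_left₀ (abs_nonneg _) hy 2
    rw [le_div_iff₀ (by positivity)]
    nlinarith [mul_le_mul_of_nonneg_left h2 (sq_nonneg Real.pi)]
  have h3 : ∫ y in Metric.closedBall x δ,
        δ⁻¹ * Real.exp (-(Real.pi * (x - y)) ^ 2 / (Real.pi * δ ^ 2)) ∂μ
      ≤ ∫ y, δ⁻¹ * Real.exp (-(Real.pi * (x - y)) ^ 2 / (Real.pi * δ ^ 2)) ∂μ :=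
    setIntegral_le_integral (hinn x) (Filter.Eventually.of_forall fun y => by positivity)
  rw [setIntegral_const, smul_eq_mul] at h1
  refine le_trans ?_ (h1.trans h3)
  rw [mul_comm]
  gcongr

lemma fourier_energy_upper {ρ : Measure ℝ} {s C δ : ℝ} (hs1 : s < 1) (hδ : 0 < δ)
    (h : ∀ ξ, ξ ≠ 0 → ‖ft1 ρ ξ‖ ^ 2 ≤ C * |ξ| ^ (-s)) :
    ∫ ξ : ℝ, Real.exp (-(Real.pi * δ ^ 2) * ξ ^ 2) * ‖ft1 ρ ξ‖ ^ 2
      ≤ C * (Real.pi ^ (-(1 - s) / 2) * Real.Gamma ((1 - s) / 2)) * δ ^ (s - 1) := by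
  have hpi := Real.pi_pos
  have hb : 0 < Real.pi * δ ^ 2 := by positivity
  have hI := integral_rpow_mul_exp_neg_mul_rpow (p := 2) (q := -s) two_pos (by linarith) hb
  have hJ : ∫ ξ : ℝ, |ξ| ^ (-s) * Real.exp (-(Real.pi * δ ^ 2) * |ξ| ^ (2 : ℝ))
      = Real.pi ^ (-(1 - s) / 2) * Real.Gamma ((1 - s) / 2) * δ ^ (s - 1) := by
    rw [integral_comp_abs (f := fun x => x ^ (-s) * Real.exp (-(Real.pi * δ ^ 2) * x ^ (2 : ℝ))),
      hI, Real.mul_rpow hpi.le (by positivity), ← Real.rpow_natCast, ← Real.rpow_mul hδ.le]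
    rw [show (-s + 1) / 2 = (1 - s) / 2 by ring, show -(-s + 1) / 2 = -(1 - s) / 2 by ring,
      show ((2 : ℕ) : ℝ) * (-(1 - s) / 2) = s - 1 by push_cast; ring]
    ring
  have hΓ : 0 < Real.Gamma ((1 - s) / 2) := Real.Gamma_pos_of_pos (by linarith)
  have hJint : Integrable fun ξ : ℝ =>
      |ξ| ^ (-s) * Real.exp (-(Real.pi * δ ^ 2) * |ξ| ^ (2 : ℝ)) := by
    by_contra hcon
    rw [integral_undef hcon] at hJ
    have : 0 < Real.pi ^ (-(1 - s) / 2) * Real.Gamma ((1 - s) / 2) * δ ^ (s - 1) := by positivity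
    linarith
  rw [mul_assoc, ← hJ, ← integral_const_mul]
  refine integral_mono_of_nonneg (Filter.Eventually.of_forall fun ξ => by positivity)
    (hJint.const_mul C) ?_
  have hne : ∀ᵐ ξ : ℝ, ξ ≠ 0 := by simp [ae_iff]
  filter_upwards [hne] with ξ hξ
  have e : |ξ| ^ (2 : ℝ) = ξ ^ 2 := by
    rw [show (2 : ℝ) = ((2 : ℕ) : ℝ) by norm_num, Real.rpow_natCast, sq_abs]
  simp only [e]
  nlinarith [h ξ hξ, Real.exp_pos (-(Real.pi * δ ^ 2) * ξ ^ 2)]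

theorem fDimM1_le_of_le_measure_closedBall {α : ℝ} (hα : 0 ≤ α)
    (h : ∀ j : ℕ, ∀ᵐ x ∂μ,
      ENNReal.ofReal (((2 ^ j)⁻¹ : ℝ) ^ α) ≤ μ (Metric.closedBall x ((2 ^ j)⁻¹))) :
    fDimM1 μ ≤ α := by
  refine csSup_le ⟨0, le_rfl, zero_le_one, 1, fun ξ => ?_⟩ ?_
  · have := norm_ft1_le μ ξ
    rw [probReal_univ] at this
    rw [Real.rpow_zero, mul_one]
    exact pow_le_one₀ (norm_nonneg _) this
  rintro s ⟨hs0, hs1, C, hC⟩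
  by_contra! hlt
  set t := (α + s) / 2 with ht
  have htα : α < t := by rw [ht]; linarith
  have hts : t < s := by rw [ht]; linarith
  have ht1 : t < 1 := by linarith
  have hC0 : 0 ≤ C := le_trans (by positivity) (hC 1)
  have hbd : ∀ ξ, ξ ≠ 0 → ‖ft1 μ ξ‖ ^ 2 ≤ (C + 1) * |ξ| ^ (-t) := by
    intro ξ hξ
    have hξ0 : 0 < |ξ| := abs_pos.2 hξ
    rw [Real.rpow_neg hξ0.le, ← div_eq_mul_inv, le_div_iff₀ (by positivity)]
    rcases le_total |ξ| 1 with h1 | h1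
    · have h2 := norm_ft1_le μ ξ
      rw [probReal_univ] at h2
      have h3 : ‖ft1 μ ξ‖ ^ 2 ≤ 1 := pow_le_one₀ (norm_nonneg _) h2
      have h4 : |ξ| ^ t ≤ 1 := Real.rpow_le_one hξ0.le h1 (by linarith)
      have h5 : ‖ft1 μ ξ‖ ^ 2 * |ξ| ^ t ≤ 1 * 1 := by gcongr
      linarith
    · have h4 : |ξ| ^ t ≤ |ξ| ^ s := Real.rpow_le_rpow_of_exponent_le h1 hts.le
      have h5 : ‖ft1 μ ξ‖ ^ 2 * |ξ| ^ t ≤ ‖ft1 μ ξ‖ ^ 2 * |ξ| ^ s := by gcongr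
      linarith [hC ξ]
  set K := (C + 1) * (Real.pi ^ (-(1 - t) / 2) * Real.Gamma ((1 - t) / 2)) with hK
  have key : ∀ j : ℕ, Real.exp (-Real.pi) ≤ K * ((2 ^ j)⁻¹ : ℝ) ^ (t - α) := by
    intro j
    have hδ : (0 : ℝ) < (2 ^ j)⁻¹ := by positivity
    set δ : ℝ := (2 ^ j)⁻¹ with hδd
    have h1 := (fourier_energy_lower hδ (h j)).trans
      (fourier_energy_upper ht1 hδ hbd)
    rw [Real.rpow_sub hδ, Real.rpow_one, ← hK] at h1
    rw [Real.rpow_sub hδ, ← mul_div_assoc, le_div_iff₀ (by positivity)]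
    have h2 : δ * (δ⁻¹ * Real.exp (-Real.pi) * δ ^ α) ≤ δ * (K * (δ ^ t / δ)) := by gcongr
    have h3 : δ * (δ⁻¹ * Real.exp (-Real.pi) * δ ^ α) = Real.exp (-Real.pi) * δ ^ α := by
      field_simp
    have h4 : δ * (K * (δ ^ t / δ)) = K * δ ^ t := by field_simp
    linarith
  have hlim : Filter.Tendsto (fun j : ℕ => K * ((2 ^ j)⁻¹ : ℝ) ^ (t - α)) Filter.atTop
      (nhds (K * (0 : ℝ) ^ (t - α))) := by
    refine Filter.Tendsto.const_mul _ (Filter.Tendsto.rpow_const ?_ (Or.inr (by linarith)))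
    exact tendsto_inv_atTop_zero.comp (tendsto_pow_atTop_atTop_of_one_lt one_lt_two)
  rw [Real.zero_rpow (by linarith), mul_zero] at hlim
  have := ge_of_tendsto' hlim key
  linarith [Real.exp_pos (-Real.pi)]

end Energy

section Decay

lemma exists_schwartz_eq_inv {K : Set ℝ} (hK : IsCompact K) (h0 : (0 : ℝ) ∉ K) :
    ∃ ψ : SchwartzMap ℝ ℂ, ∀ y ∈ K, ψ y = (y : ℂ)⁻¹ := by
  obtain ⟨r, hr, hrK⟩ := Metric.isOpen_iff.1 hK.isClosed.isOpen_compl 0 h0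
  obtain ⟨R, hR⟩ := hK.isBounded.subset_closedBall 0
  let φ : ContDiffBump (0 : ℝ) := ⟨r / 2, r, half_pos hr, half_lt_self hr⟩
  let χ : ContDiffBump (0 : ℝ) := ⟨|R| + 1, |R| + 2, by positivity, by linarith⟩
  have hden : ∀ y : ℝ, y ^ 2 + φ y ≠ 0 := by
    intro y
    rcases eq_or_ne y 0 with rfl | hy
    · have : φ (0 : ℝ) = 1 :=
        φ.one_of_mem_closedBall (Metric.mem_closedBall_self (half_pos hr).le)
      rw [this]
      norm_num
    · have := φ.nonneg (x := y)
      positivity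
  have hcs : HasCompactSupport fun y : ℝ => ((χ y * (y / (y ^ 2 + φ y)) : ℝ) : ℂ) :=
    (χ.hasCompactSupport.mul_right (f' := fun y : ℝ => y / (y ^ 2 + φ y))).comp_left
      (g := Complex.ofReal) Complex.ofReal_zero
  have hsm : ContDiff ℝ ((⊤ : ℕ∞) : WithTop ℕ∞)
      fun y : ℝ => ((χ y * (y / (y ^ 2 + φ y)) : ℝ) : ℂ) := by
    refine Complex.ofRealCLM.contDiff.comp (χ.contDiff.mul ?_)
    exact contDiff_id.div ((contDiff_id.pow 2).add φ.contDiff) hden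
  refine ⟨hcs.toSchwartzMap hsm, fun y hy => ?_⟩
  have hχ : χ y = 1 := by
    refine χ.one_of_mem_closedBall ?_
    have := hR hy
    simp only [mem_closedBall_zero_iff] at this ⊢
    change ‖y‖ ≤ |R| + 1
    linarith [le_abs_self R]
  have hφ : φ y = 0 := by
    refine φ.zero_of_le_dist ?_
    by_contra! hlt
    exact hrK (Metric.mem_ball.2 hlt) hy
  have hy0 : y ≠ 0 := fun h => h0 (h ▸ hy)
  change ((χ y * (y / (y ^ 2 + φ y)) : ℝ) : ℂ) = _
  rw [hχ, hφ, ← Complex.ofReal_inv]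
  congr 1
  field_simp
  ring

lemma integral_schwartz_mul_exp (ν : Measure ℝ) [IsFiniteMeasure ν] (ψ : SchwartzMap ℝ ℂ) (η : ℝ) :
    ∫ y, ψ y * Complex.exp (((-2 * Real.pi * y * η : ℝ) : ℂ) * Complex.I) ∂ν
      = ∫ t, (FourierTransform.fourier ψ : SchwartzMap ℝ ℂ) t * ft1 ν (η - t) := by
  set Ψ := (FourierTransform.fourier ψ : SchwartzMap ℝ ℂ) with hΨ
  have hinv : ∀ y : ℝ, ψ y
      = ∫ t, Complex.exp (((2 * Real.pi * t * y : ℝ) : ℂ) * Complex.I) * Ψ t := by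
    intro y
    have h1 := Continuous.fourierInv_fourier_eq ψ.continuous ψ.integrable
      (by rw [← SchwartzMap.fourier_coe]; exact Ψ.integrable)
    have h2 := congrFun h1 y
    rw [← h2, Real.fourierInv_eq', ← SchwartzMap.fourier_coe]
    refine integral_congr_ae (Filter.Eventually.of_forall fun t => ?_)
    simp only [smul_eq_mul]
    congr 4
    simp
    ring
  have hswap : Integrable (Function.uncurry fun (y t : ℝ) =>
      Ψ t * Complex.exp (((-2 * Real.pi * y * (η - t) : ℝ) : ℂ) * Complex.I))
      (ν.prod volume) := by
    have h1 : Integrable (fun z : ℝ × ℝ => (1 : ℝ) * ‖Ψ z.2‖) (ν.prod volume) :=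
      (integrable_const (1 : ℝ)).mul_prod Ψ.integrable.norm
    refine h1.mono' (Continuous.aestronglyMeasurable ?_) (Filter.Eventually.of_forall ?_)
    · have := Ψ.continuous
      unfold Function.uncurry
      fun_prop
    · rintro ⟨y, t⟩
      simp only [Function.uncurry, norm_mul]
      rw [norm_exp_ofReal_mul_I_integrand]
      simp
  have h3 := integral_integral_swap hswap
  have hL : ∀ y : ℝ, (∫ t, Ψ t * Complex.exp (((-2 * Real.pi * y * (η - t) : ℝ) : ℂ) * Complex.I))
      = ψ y * Complex.exp (((-2 * Real.pi * y * η : ℝ) : ℂ) * Complex.I) := by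
    intro y
    rw [hinv y, ← integral_mul_const]
    refine integral_congr_ae (Filter.Eventually.of_forall fun t => ?_)
    simp only
    have hexp : Complex.exp (((-2 * Real.pi * y * (η - t) : ℝ) : ℂ) * Complex.I)
        = Complex.exp (((2 * Real.pi * t * y : ℝ) : ℂ) * Complex.I)
          * Complex.exp (((-2 * Real.pi * y * η : ℝ) : ℂ) * Complex.I) := by
      rw [← Complex.exp_add]
      congr 1
      push_cast
      ring
    rw [hexp]
    ring
  simp_rw [hL, integral_const_mul] at h3
  exact h3

lemma norm_ft1_le_rpow {ν : Measure ℝ} [IsFiniteMeasure ν] {s : ℝ}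
    (h : ∃ C : ℝ, ∀ ξ, ‖ft1 ν ξ‖ ^ 2 * |ξ| ^ s ≤ C) :
    ∃ C : ℝ, 0 ≤ C ∧ ∀ ξ, ξ ≠ 0 → ‖ft1 ν ξ‖ ≤ C * |ξ| ^ (-(s / 2)) := by
  obtain ⟨C, hC⟩ := h
  have hC0 : 0 ≤ C := le_trans (by positivity) (hC 1)
  refine ⟨√C, Real.sqrt_nonneg _, fun ξ hξ => ?_⟩
  have hξ0 : 0 < |ξ| := abs_pos.2 hξ
  rw [Real.rpow_neg hξ0.le, ← div_eq_mul_inv, le_div_iff₀ (by positivity)]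
  refine Real.le_sqrt_of_sq_le ?_
  rw [mul_pow, ← Real.rpow_natCast (|ξ| ^ (s / 2)), ← Real.rpow_mul hξ0.le]
  norm_num
  exact hC ξ

lemma norm_integral_schwartz_mul_exp_le {ν : Measure ℝ} [IsFiniteMeasure ν] {s : ℝ} (hs0 : 0 ≤ s)
    (hs1 : s ≤ 1) (h : ∃ C : ℝ, ∀ ξ, ‖ft1 ν ξ‖ ^ 2 * |ξ| ^ s ≤ C) (ψ : SchwartzMap ℝ ℂ) :
    ∃ C : ℝ, 0 ≤ C ∧ ∀ η : ℝ, 1 ≤ η →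
      ‖∫ y, ψ y * Complex.exp (((-2 * Real.pi * y * η : ℝ) : ℂ) * Complex.I) ∂ν‖
        ≤ C * η ^ (-(s / 2)) := by
  obtain ⟨C, hC0, hC⟩ := norm_ft1_le_rpow h
  set N := ν.real Set.univ with hN
  have hN0 : 0 ≤ N := measureReal_nonneg
  set Ψ := (FourierTransform.fourier ψ : SchwartzMap ℝ ℂ) with hΨ
  have hpt : ∀ η : ℝ, 1 ≤ η → ∀ t,
      ‖ft1 ν (η - t)‖ ≤ (2 * C + 2 * N) * (1 + |t|) * η ^ (-(s / 2)) := by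
    intro η hη t
    have hη0 : 0 < η := by linarith
    have hηs : 0 < η ^ (-(s / 2)) := Real.rpow_pos_of_pos hη0 _
    rcases le_total |t| (η / 2) with ht | ht
    · have h1 : η / 2 ≤ |η - t| := by
        have := (le_abs_self t).trans ht
        exact le_trans (by linarith) (le_abs_self _)
      have h2 : η - t ≠ 0 := by
        rw [← abs_pos]; linarith
      have h3 : |η - t| ^ (-(s / 2)) ≤ (η / 2) ^ (-(s / 2)) :=
        Real.rpow_le_rpow_of_nonpos (by linarith) h1 (by linarith)
      have h4 : (η / 2) ^ (-(s / 2)) ≤ 2 * η ^ (-(s / 2)) := by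
        rw [div_eq_mul_inv, Real.mul_rpow hη0.le (by norm_num), mul_comm,
          Real.inv_rpow two_pos.le, Real.rpow_neg two_pos.le, inv_inv]
        refine mul_le_mul_of_nonneg_right ?_ hηs.le
        calc (2 : ℝ) ^ (s / 2) ≤ 2 ^ (1 : ℝ) :=
              Real.rpow_le_rpow_of_exponent_le one_le_two (by linarith)
          _ = 2 := Real.rpow_one 2
      calc ‖ft1 ν (η - t)‖ ≤ C * |η - t| ^ (-(s / 2)) := hC _ h2
        _ ≤ C * (2 * η ^ (-(s / 2))) := by gcongr; exact h3.trans h4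
        _ = (2 * C) * 1 * η ^ (-(s / 2)) := by ring
        _ ≤ (2 * C + 2 * N) * (1 + |t|) * η ^ (-(s / 2)) := by
          gcongr
          · linarith
          · linarith [abs_nonneg t]
    · have h1 : η⁻¹ ≤ η ^ (-(s / 2)) := by
        rw [← Real.rpow_neg_one]
        exact Real.rpow_le_rpow_of_exponent_le hη (by linarith)
      have h2 : 1 ≤ 2 * ((1 + |t|) * η ^ (-(s / 2))) := by
        have : η * η⁻¹ = 1 := mul_inv_cancel₀ hη0.ne'
        have h5 : η / 2 * η⁻¹ ≤ (1 + |t|) * η ^ (-(s / 2)) := by gcongr; linarith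
        linarith
      have h3 : 0 ≤ (1 + |t|) * η ^ (-(s / 2)) := by positivity
      calc ‖ft1 ν (η - t)‖ ≤ N := norm_ft1_le ν _
        _ ≤ N * (2 * ((1 + |t|) * η ^ (-(s / 2)))) := le_mul_of_one_le_right hN0 h2
        _ ≤ (2 * C + 2 * N) * (1 + |t|) * η ^ (-(s / 2)) := by nlinarith
  have hI0 : Integrable fun t : ℝ => (1 + |t|) * ‖Ψ t‖ := by
    have h0 := Ψ.integrable.norm (μ := volume)
    have h1 := Ψ.integrable_pow_mul volume 1
    refine (h0.add h1).congr (Filter.Eventually.of_forall fun t => ?_)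
    simp only [Pi.add_apply, pow_one, Real.norm_eq_abs]
    ring
  refine ⟨(2 * C + 2 * N) * ∫ t, (1 + |t|) * ‖Ψ t‖, ?_, fun η hη => ?_⟩
  · exact mul_nonneg (by positivity) (integral_nonneg fun t => by positivity)
  · rw [integral_schwartz_mul_exp, ← hΨ, mul_right_comm, ← integral_const_mul]
    refine norm_integral_le_of_norm_le (hI0.const_mul _) (Filter.Eventually.of_forall fun t => ?_)
    rw [norm_mul]
    calc ‖Ψ t‖ * ‖ft1 ν (η - t)‖
        ≤ ‖Ψ t‖ * ((2 * C + 2 * N) * (1 + |t|) * η ^ (-(s / 2))) := by gcongr; exact hpt η hη t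
      _ = _ := by ring

lemma norm_integral_ft1_le {ν : Measure ℝ} [IsFiniteMeasure ν] {K : Set ℝ} (hK : IsCompact K)
    (hK0 : (0 : ℝ) ∉ K) (hνK : ν Kᶜ = 0) {s : ℝ} (hs0 : 0 ≤ s)
    (hs1 : s ≤ 1) (h : ∃ C : ℝ, ∀ ξ, ‖ft1 ν ξ‖ ^ 2 * |ξ| ^ s ≤ C) :
    ∃ C : ℝ, 0 ≤ C ∧ ∀ ξ : ℝ, 1 ≤ ξ → ∀ a b : ℝ, 1 ≤ a → a ≤ b →
      ‖∫ x in a..b, ft1 ν (x * ξ)‖ ≤ C * ξ ^ (-(s / 2)) * ξ⁻¹ := by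
  obtain ⟨ψ, hψ⟩ := exists_schwartz_eq_inv hK hK0
  obtain ⟨C, hC0, hC⟩ := norm_integral_schwartz_mul_exp_le hs0 hs1 h ψ
  refine ⟨C, hC0, fun ξ hξ a b ha hab => ?_⟩
  have hξ0 : 0 < ξ := by linarith
  have hpi := Real.pi_pos
  set G : ℝ → ℂ := fun η =>
    ∫ y, ψ y * Complex.exp (((-2 * Real.pi * y * η : ℝ) : ℂ) * Complex.I) ∂ν with hG
  have hint : ∀ η, Integrable (fun y =>
      ψ y * Complex.exp (((-2 * Real.pi * y * η : ℝ) : ℂ) * Complex.I)) ν := by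
    intro η
    obtain ⟨B, hB⟩ := ψ.decay 0 0
    refine Integrable.mono' (integrable_const B) (Continuous.aestronglyMeasurable ?_)
      (Filter.Eventually.of_forall fun y => ?_)
    · have := ψ.continuous
      fun_prop
    · rw [norm_mul, norm_exp_ofReal_mul_I_integrand, mul_one]
      simpa using hB.2 y
  have hsw : Integrable (Function.uncurry fun (x y : ℝ) =>
      Complex.exp (((-2 * Real.pi * y * (x * ξ) : ℝ) : ℂ) * Complex.I))
      ((volume.restrict (Set.Ioc a b)).prod ν) := by
    refine Integrable.mono' (integrable_const (1 : ℝ)) (Continuous.aestronglyMeasurable ?_)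
      (Filter.Eventually.of_forall fun z => (norm_exp_ofReal_mul_I_integrand _ _).le)
    unfold Function.uncurry
    fun_prop
  have hne : (-2 * Real.pi * ξ * Complex.I : ℂ) ≠ 0 := by
    simp [hpi.ne', hξ0.ne']
  have e1 : ∫ x in a..b, ft1 ν (x * ξ)
      = (G (b * ξ) - G (a * ξ)) / (-2 * Real.pi * ξ * Complex.I) := by
    rw [intervalIntegral.integral_of_le hab]
    unfold ft1
    rw [integral_integral_swap hsw, hG]
    simp only
    rw [← integral_sub (hint _) (hint _), ← integral_div]
    have hae : ∀ᵐ y ∂ν, y ∈ K := by rw [ae_iff]; exact hνK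
    refine integral_congr_ae ?_
    filter_upwards [hae] with y hy
    have hy0 : (y : ℂ) ≠ 0 := by
      rw [Complex.ofReal_ne_zero]
      exact fun h => hK0 (h ▸ hy)
    have hc : (-2 * Real.pi * ξ * Complex.I * y : ℂ) ≠ 0 := mul_ne_zero hne hy0
    rw [← intervalIntegral.integral_of_le hab, hψ y hy]
    have e2 : ∀ x : ℝ, Complex.exp (((-2 * Real.pi * y * (x * ξ) : ℝ) : ℂ) * Complex.I)
        = Complex.exp ((-2 * Real.pi * ξ * Complex.I * y : ℂ) * x) := by
      intro x
      congr 1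
      push_cast
      ring
    simp_rw [e2]
    rw [integral_exp_mul_complex hc, ← mul_sub, div_eq_mul_inv, mul_inv, div_eq_mul_inv]
    ring
  rw [e1, norm_div]
  have hnorm : ‖(-2 * Real.pi * ξ * Complex.I : ℂ)‖ = 2 * Real.pi * ξ := by
    simp [abs_of_pos hpi, abs_of_pos hξ0]
  rw [hnorm, div_le_iff₀ (by positivity)]
  have hmono : ∀ x : ℝ, 1 ≤ x → ‖G (x * ξ)‖ ≤ C * ξ ^ (-(s / 2)) := by
    intro x hx
    have h1 : ξ ≤ x * ξ := le_mul_of_one_le_left hξ0.le hx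
    refine (hC (x * ξ) (hξ.trans h1)).trans ?_
    exact mul_le_mul_of_nonneg_left (Real.rpow_le_rpow_of_nonpos hξ0 h1 (by linarith)) hC0
  have h2 := norm_sub_le (G (b * ξ)) (G (a * ξ))
  have h3 := hmono a ha
  have h4 := hmono b (ha.trans hab)
  have h5 : C * ξ ^ (-(s / 2)) * ξ⁻¹ * (2 * Real.pi * ξ) = 2 * Real.pi * (C * ξ ^ (-(s / 2))) := by
    field_simp
  rw [h5]
  have h6 : 0 ≤ C * ξ ^ (-(s / 2)) := by positivity
  nlinarith [Real.pi_gt_three]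

end Decay

section Combine

lemma abs_integral_treeMeasure_le {α θ : ℝ} (hθ : 2 * θ < α) {m : ℕ → ℕ} {a : ℕ → ℕ → ℕ}
    (h : IsDyadicTree m a) (hm : ∀ j : ℕ, α * j ≤ m j + 1) (hθ1 : θ ≤ 1 / 2) {g : ℝ → ℝ}
    (hg : Continuous g) {M : ℝ}
    (hM : ∀ x, |g x| ≤ M) {P lam : ℝ} (hP : 0 ≤ P) (hlam : 0 ≤ lam)
    (hcell : ∀ j p, |cellAvg g j p| ≤ P * (2 ^ j : ℝ) ^ θ)
    (hstep : ∀ j B, (∀ p, |cellAvg g (j + 1) p| ≤ B) →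
      |treeAvg g (m (j + 1)) (j + 1) (a (j + 1)) - treeAvg g (m j) j (a j)|
        ≤ lam * (B / √(2 ^ m j))) :
    |∫ x, g x ∂(treeMeasure m a)| ≤ P * (1 + 4 * lam / (1 - 2 ^ (θ - α / 2))) := by
  set q : ℝ := 2 ^ (θ - α / 2) with hq
  have hq0 : 0 < q := by positivity
  have hq1 : q < 1 := Real.rpow_lt_one_of_one_lt_of_neg one_lt_two (by linarith)
  have hinc : ∀ j, |treeAvg g (m (j + 1)) (j + 1) (a (j + 1)) - treeAvg g (m j) j (a j)|
      ≤ P * (4 * lam) * q ^ j := by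
    intro j
    refine (hstep j _ (hcell (j + 1))).trans ?_
    have hs : (2 : ℝ) ^ ((α * j - 1) / 2) ≤ √(2 ^ m j) := by
      rw [Real.sqrt_eq_rpow, ← Real.rpow_natCast, ← Real.rpow_mul two_pos.le]
      exact Real.rpow_le_rpow_of_exponent_le one_le_two (by have := hm j; linarith)
    have hnum : ((2 : ℝ) ^ (j + 1)) ^ θ = 2 ^ (((j : ℝ) + 1) * θ) := by
      rw [← Real.rpow_natCast, ← Real.rpow_mul two_pos.le]
      push_cast
      rfl
    have hfrac : ((2 : ℝ) ^ (j + 1)) ^ θ / √(2 ^ m j) ≤ 4 * q ^ j := by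
      rw [div_le_iff₀ (by positivity), hnum]
      calc (2 : ℝ) ^ (((j : ℝ) + 1) * θ)
          ≤ 2 ^ (2 + (θ - α / 2) * j + (α * j - 1) / 2) :=
            Real.rpow_le_rpow_of_exponent_le one_le_two (by linarith)
        _ = 4 * q ^ j * 2 ^ ((α * j - 1) / 2) := by
            rw [Real.rpow_add two_pos, Real.rpow_add two_pos, Real.rpow_mul two_pos.le,
              Real.rpow_natCast, ← hq]
            norm_num
        _ ≤ _ := by gcongr
    calc lam * (P * ((2 : ℝ) ^ (j + 1)) ^ θ / √(2 ^ m j))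
        = lam * P * (((2 : ℝ) ^ (j + 1)) ^ θ / √(2 ^ m j)) := by ring
      _ ≤ lam * P * (4 * q ^ j) := by gcongr
      _ = _ := by ring
  have hzero : |treeAvg g (m 0) 0 (a 0)| ≤ P := by
    have := hcell 0 0
    simpa [treeAvg, h.m_zero, h.zero] using this
  have hbound : ∀ J, |treeAvg g (m J) J (a J)|
      ≤ P * (1 + 4 * lam * ∑ j ∈ Finset.range J, q ^ j) := by
    intro J
    induction J with
    | zero => simpa using hzero
    | succ J ih =>
      have h1 := abs_sub_abs_le_abs_sub (treeAvg g (m (J + 1)) (J + 1) (a (J + 1)))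
        (treeAvg g (m J) J (a J))
      have h2 := hinc J
      rw [Finset.sum_range_succ]
      linarith
  refine le_of_tendsto (h.tendsto_treeAvg hg hM).abs (Filter.Eventually.of_forall fun J => ?_)
  refine (hbound J).trans ?_
  have hgeo : ∑ j ∈ Finset.range J, q ^ j ≤ (1 - q)⁻¹ := by
    rw [← tsum_geometric_of_lt_one hq0.le hq1]
    exact (summable_geometric_of_lt_one hq0.le hq1).sum_le_tsum _ fun _ _ => by positivity
  rw [div_eq_mul_inv]
  gcongr

lemma abs_cellAvg_ft1_le {ν : Measure ℝ} [IsFiniteMeasure ν] {K : Set ℝ} (hK : IsCompact K)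
    (hK0 : (0 : ℝ) ∉ K) (hνK : ν Kᶜ = 0) (hcont : Continuous (ft1 ν)) {s : ℝ} (hs0 : 0 ≤ s)
    (hs1 : s ≤ 1) (h : ∃ C : ℝ, ∀ ξ, ‖ft1 ν ξ‖ ^ 2 * |ξ| ^ s ≤ C) :
    ∃ C : ℝ, 0 ≤ C ∧ ∀ L : ℂ →L[ℝ] ℝ, (∀ z, |L z| ≤ ‖z‖) → ∀ θ : ℝ, 0 ≤ θ → θ ≤ 1 →
      ∀ ξ : ℝ, 1 ≤ ξ → ∀ j p : ℕ,
      |cellAvg (fun x => L (ft1 ν (x * ξ))) j p|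
        ≤ C * ξ ^ (-(s / 2)) * ξ ^ (-θ) * (2 ^ j : ℝ) ^ θ := by
  obtain ⟨C₁, hC₁, H₁⟩ := norm_ft1_le_rpow h
  obtain ⟨C₂, hC₂, H₂⟩ := norm_integral_ft1_le hK hK0 hνK hs0 hs1 h
  refine ⟨C₁ + C₂, by positivity, fun L hL θ hθ0 hθ1 ξ hξ j p => ?_⟩
  have hξ0 : 0 < ξ := by linarith
  have hp : 1 ≤ 1 + (p : ℝ) / 2 ^ j := by
    have : 0 ≤ (p : ℝ) / 2 ^ j := by positivity
    linarith
  have hpp : 1 + (p : ℝ) / 2 ^ j ≤ 1 + ((p : ℝ) + 1) / 2 ^ j := by gcongr; linarith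
  have hcL : Continuous fun x => ft1 ν (x * ξ) := hcont.comp (continuous_id.mul continuous_const)
  have hP : 0 ≤ ξ ^ (-(s / 2)) := by positivity
  have hθe : ξ ^ (-θ) * (2 ^ j : ℝ) ^ θ = (2 ^ j / ξ) ^ θ := by
    rw [Real.div_rpow (by positivity) hξ0.le, Real.rpow_neg hξ0.le]
    ring
  rw [mul_assoc, hθe]
  have hpos : (0 : ℝ) < 2 ^ j / ξ := by positivity
  rcases le_total 1 ((2 : ℝ) ^ j / ξ) with hle | hle
  · have h1 := abs_cellAvg_sub_le (g := fun x => L (ft1 ν (x * ξ))) (L.continuous.comp hcL) j p 0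
      (C₁ * ξ ^ (-(s / 2))) (by
        intro x hx
        have hx1 : ξ ≤ x * ξ := le_mul_of_one_le_left hξ0.le (hp.trans hx.1)
        rw [sub_zero]
        refine (hL _).trans ((H₁ _ (by linarith)).trans ?_)
        refine mul_le_mul_of_nonneg_left ?_ hC₁
        exact Real.rpow_le_rpow_of_nonpos hξ0 (hx1.trans (le_abs_self _)) (by linarith))
    rw [sub_zero] at h1
    calc _ ≤ C₁ * ξ ^ (-(s / 2)) := h1
      _ ≤ (C₁ + C₂) * ξ ^ (-(s / 2)) * 1 := by rw [mul_one]; gcongr; linarith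
      _ ≤ _ := by gcongr; exact Real.one_le_rpow hle hθ0
  · have e1 : cellAvg (fun x => L (ft1 ν (x * ξ))) j p = 2 ^ j *
        L (∫ x in (1 + (p : ℝ) / 2 ^ j)..(1 + ((p : ℝ) + 1) / 2 ^ j), ft1 ν (x * ξ)) := by
      rw [cellAvg, L.intervalIntegral_comp_comm (hcL.intervalIntegrable _ _)]
    rw [e1, abs_mul, abs_of_pos (by positivity)]
    calc _ ≤ 2 ^ j * (C₂ * ξ ^ (-(s / 2)) * ξ⁻¹) := by
          gcongr
          exact (hL _).trans (H₂ ξ hξ _ _ hp hpp)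
      _ = C₂ * ξ ^ (-(s / 2)) * (2 ^ j / ξ) := by ring
      _ ≤ (C₁ + C₂) * ξ ^ (-(s / 2)) * (2 ^ j / ξ) ^ θ := by
          gcongr
          · linarith
          · simpa using Real.rpow_le_rpow_of_exponent_ge hpos hle hθ1

lemma norm_ft1_sub_le {ρ : Measure ℝ} [IsFiniteMeasure ρ] {R : ℝ} (hR : ∀ᵐ x ∂ρ, |x| ≤ R)
    (ξ η : ℝ) : ‖ft1 ρ ξ - ft1 ρ η‖ ≤ 2 * Real.pi * R * |ξ - η| * ρ.real Set.univ := by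
  have hint : ∀ ξ, Integrable
      (fun x : ℝ => Complex.exp (((-2 * Real.pi * x * ξ : ℝ) : ℂ) * Complex.I)) ρ := by
    intro ξ
    refine Integrable.mono' (integrable_const (1 : ℝ)) (Continuous.aestronglyMeasurable ?_)
      (Filter.Eventually.of_forall fun x => (norm_exp_ofReal_mul_I_integrand _ _).le)
    fun_prop
  rw [ft1, ft1, ← integral_sub (hint _) (hint _)]
  refine norm_integral_le_of_norm_le_const ?_
  filter_upwards [hR] with x hx
  have e : Complex.exp (((-2 * Real.pi * x * ξ : ℝ) : ℂ) * Complex.I)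
      - Complex.exp (((-2 * Real.pi * x * η : ℝ) : ℂ) * Complex.I)
      = Complex.exp (((-2 * Real.pi * x * η : ℝ) : ℂ) * Complex.I)
        * (Complex.exp (Complex.I * ((-2 * Real.pi * x * (ξ - η) : ℝ) : ℂ)) - 1) := by
    rw [mul_sub, ← Complex.exp_add, mul_one]
    congr 2
    push_cast
    ring
  rw [e, norm_mul, norm_exp_ofReal_mul_I_integrand, one_mul]
  refine (Real.norm_exp_I_mul_ofReal_sub_one_le).trans ?_
  rw [Real.norm_eq_abs, abs_mul, abs_mul, abs_mul, abs_of_pos Real.pi_pos]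
  norm_num
  have := Real.pi_pos
  gcongr

lemma continuous_ft1 (ρ : Measure ℝ) [IsFiniteMeasure ρ] : Continuous (ft1 ρ) := by
  refine continuous_of_dominated (bound := fun _ => 1) (fun ξ => ?_) (fun ξ => ?_)
    (integrable_const _) (Filter.Eventually.of_forall fun x => ?_)
  · exact Continuous.aestronglyMeasurable (by fun_prop)
  · exact Filter.Eventually.of_forall fun x => (norm_exp_ofReal_mul_I_integrand _ _).le
  · fun_prop

lemma ft1_neg (ρ : Measure ℝ) (ξ : ℝ) : ft1 ρ (-ξ) = (starRingEnd ℂ) (ft1 ρ ξ) := by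
  rw [ft1, ft1, ← integral_conj]
  congr 1
  ext x
  rw [← Complex.exp_conj]
  congr 1
  simp only [map_mul, Complex.conj_ofReal, Complex.conj_I]
  push_cast
  ring

/-- Decay of the Fourier transform along `√n` propagates to all frequencies. -/
lemma exists_decay_of_sqrt {ρ : Measure ℝ} [IsFiniteMeasure ρ] {R : ℝ} (hR0 : 0 ≤ R)
    (hR : ∀ᵐ x ∂ρ, |x| ≤ R)
    {σ C : ℝ} (hσ0 : 0 ≤ σ) (hσ1 : σ ≤ 1) (hC : 0 ≤ C)
    (h : ∀ n : ℕ, 1 ≤ n → ‖ft1 ρ √n‖ ≤ C * (√n : ℝ) ^ (-(σ / 2))) :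
    ∃ C : ℝ, ∀ ξ, ‖ft1 ρ ξ‖ ^ 2 * |ξ| ^ σ ≤ C := by
  have hpi := Real.pi_pos
  set L : ℝ := 2 * Real.pi * R * ρ.real Set.univ with hL
  have hL0 : 0 ≤ L := by positivity
  have key : ∀ ξ : ℝ, 1 ≤ ξ → ‖ft1 ρ ξ‖ ^ 2 * ξ ^ σ ≤ (2 * C + L) ^ 2 := by
    intro ξ hξ
    have hξ0 : 0 < ξ := by linarith
    set n := ⌊ξ ^ 2⌋₊ with hn
    have hn1 : 1 ≤ n := Nat.le_floor (by push_cast; nlinarith)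
    have hn1' : (1 : ℝ) ≤ n := by exact_mod_cast hn1
    have hle : (n : ℝ) ≤ ξ ^ 2 := Nat.floor_le (by positivity)
    have hlt : ξ ^ 2 < n + 1 := Nat.lt_floor_add_one _
    have hs : √(n : ℝ) ^ 2 = n := Real.sq_sqrt (by positivity)
    have hs0 : 0 < √(n : ℝ) := Real.sqrt_pos.2 (by linarith)
    have hs1 : √(n : ℝ) ≤ ξ := by
      rw [← Real.sqrt_sq hξ0.le]; exact Real.sqrt_le_sqrt hle
    have hs2 : ξ / 2 ≤ √(n : ℝ) := Real.le_sqrt_of_sq_le (by nlinarith)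
    have hd : |ξ - √n| ≤ ξ⁻¹ := by
      rw [abs_of_nonneg (by linarith), ← one_div, le_div_iff₀ hξ0]
      nlinarith
    have hp : (√(n : ℝ)) ^ (-(σ / 2)) ≤ 2 * ξ ^ (-(σ / 2)) := by
      refine (Real.rpow_le_rpow_of_nonpos (by linarith) hs2 (by linarith)).trans ?_
      rw [div_eq_mul_inv, Real.mul_rpow hξ0.le (by norm_num), mul_comm,
        Real.inv_rpow two_pos.le, Real.rpow_neg two_pos.le, inv_inv]
      refine mul_le_mul_of_nonneg_right ?_ (by positivity)
      calc (2 : ℝ) ^ (σ / 2) ≤ 2 ^ (1 : ℝ) :=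
            Real.rpow_le_rpow_of_exponent_le one_le_two (by linarith)
        _ = 2 := Real.rpow_one 2
    have hinv : ξ⁻¹ ≤ ξ ^ (-(σ / 2)) := by
      rw [← Real.rpow_neg_one]
      exact Real.rpow_le_rpow_of_exponent_le hξ (by linarith)
    have hsub : ‖ft1 ρ ξ - ft1 ρ √n‖ ≤ L * ξ ^ (-(σ / 2)) := by
      refine (norm_ft1_sub_le hR _ _).trans ?_
      calc 2 * Real.pi * R * |ξ - √n| * ρ.real Set.univ = L * |ξ - √n| := by rw [hL]; ring
        _ ≤ L * ξ ^ (-(σ / 2)) := by gcongr; exact hd.trans hinv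
    have hnorm : ‖ft1 ρ ξ‖ ≤ (2 * C + L) * ξ ^ (-(σ / 2)) := by
      have h1 := norm_sub_norm_le (ft1 ρ ξ) (ft1 ρ √n)
      have h2 := (h n hn1).trans (mul_le_mul_of_nonneg_left hp hC)
      linarith
    have hcancel : (ξ ^ (-(σ / 2))) ^ 2 * ξ ^ σ = 1 := by
      rw [← Real.rpow_natCast, ← Real.rpow_mul hξ0.le, ← Real.rpow_add hξ0]
      norm_num
    calc ‖ft1 ρ ξ‖ ^ 2 * ξ ^ σ ≤ ((2 * C + L) * ξ ^ (-(σ / 2))) ^ 2 * ξ ^ σ := by gcongr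
      _ = (2 * C + L) ^ 2 * ((ξ ^ (-(σ / 2))) ^ 2 * ξ ^ σ) := by ring
      _ = _ := by rw [hcancel, mul_one]
  refine ⟨max ((2 * C + L) ^ 2) (ρ.real Set.univ ^ 2), fun ξ => ?_⟩
  have habs : ‖ft1 ρ |ξ|‖ = ‖ft1 ρ ξ‖ := by
    rcases abs_choice ξ with h | h
    · rw [h]
    · rw [h, ft1_neg, RCLike.norm_conj]
  rcases le_total 1 |ξ| with h1 | h1
  · rw [← habs]
    exact (key _ h1).trans (le_max_left _ _)
  · refine le_trans ?_ (le_max_right _ _)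
    have h2 := Real.rpow_le_one (abs_nonneg ξ) h1 hσ0
    have h3 := norm_ft1_le ρ ξ
    calc ‖ft1 ρ ξ‖ ^ 2 * |ξ| ^ σ ≤ ‖ft1 ρ ξ‖ ^ 2 * 1 := by gcongr
      _ ≤ ρ.real Set.univ ^ 2 := by rw [mul_one]; gcongr

lemma ft1_mulConv1 (μ ν : Measure ℝ) [IsFiniteMeasure μ] [IsFiniteMeasure ν] (ξ : ℝ) :
    ft1 (mulConv1 μ ν) ξ = ∫ x, ft1 ν (x * ξ) ∂μ := by
  rw [ft1, mulConv1, integral_map (by fun_prop) (Continuous.aestronglyMeasurable (by fun_prop)),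
    integral_prod]
  · unfold ft1
    congr 1; ext x; congr 1; ext y; congr 3
    ring
  · refine Integrable.mono' (integrable_const (1 : ℝ)) (Continuous.aestronglyMeasurable ?_)
      (Filter.Eventually.of_forall fun x => (norm_exp_ofReal_mul_I_integrand _ _).le)
    fun_prop

end Combine

section Main

lemma summable_weight : Summable fun i : ℕ × Bool × Bool => 1 / ((i.1 : ℝ) + 1) ^ 2 := by
  have h1 : Summable fun n : ℕ => 1 / ((n : ℝ) + 1) ^ 2 := by
    have := (summable_nat_add_iff 1).2 (Real.summable_one_div_nat_pow.2 (one_lt_two))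
    simpa using this
  have h2 : Summable fun _ : Bool × Bool => (1 : ℝ) := (hasSum_fintype _).summable
  have := h1.mul_of_nonneg h2 (fun n => by positivity) (fun _ => zero_le_one)
  simpa using this

lemma log_weight_le {W ε : ℝ} (hW : 0 < W) (hε : 0 < ε) {n : ℕ} (hn : 1 ≤ n) :
    Real.log (4 * W / (1 / ((n : ℝ) + 1) ^ 2)) ≤ (16 * W) ^ (ε / 4) / (ε / 4) * √n ^ ε := by
  have hn' : (1 : ℝ) ≤ n := by exact_mod_cast hn
  have hs : √(n : ℝ) ^ 2 = n := Real.sq_sqrt (by positivity)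
  have h1 : 4 * W / (1 / ((n : ℝ) + 1) ^ 2) ≤ 16 * W * √(n : ℝ) ^ 4 := by
    rw [show √(n : ℝ) ^ 4 = (√(n : ℝ) ^ 2) ^ 2 by ring, hs, div_div_eq_mul_div, div_one,
      show 16 * W * (n : ℝ) ^ 2 = 4 * W * (2 * n) ^ 2 by ring]
    gcongr
    linarith
  refine (Real.log_le_rpow_div (by positivity) (by positivity : 0 < ε / 4)).trans ?_
  rw [div_mul_eq_mul_div]
  gcongr
  refine (Real.rpow_le_rpow (by positivity) h1 (by positivity)).trans (le_of_eq ?_)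
  rw [Real.mul_rpow (by positivity) (by positivity), ← Real.rpow_natCast (√(n : ℝ)) 4,
    ← Real.rpow_mul (Real.sqrt_nonneg _)]
  congr 2
  push_cast
  ring

lemma exists_dyadicTree_decay {α : ℝ} (hα0 : 0 < α) (hα1 : α ≤ 1) (ν : Bool → Measure ℝ)
    [∀ b, IsFiniteMeasure (ν b)] (K : Bool → Set ℝ) (hK : ∀ b, IsCompact (K b))
    (hK0 : ∀ b, (0 : ℝ) ∉ K b) (hνK : ∀ b, ν b (K b)ᶜ = 0) :
    ∃ a, IsDyadicTree (fun j => ⌊α * j⌋₊) a ∧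
      ∀ b s σ, 0 ≤ s → s ≤ 1 → (∃ C : ℝ, ∀ ξ, ‖ft1 (ν b) ξ‖ ^ 2 * |ξ| ^ s ≤ C) →
        σ < s + α → ∃ C : ℝ, 0 ≤ C ∧ ∀ n : ℕ, 1 ≤ n →
          ‖∫ x, ft1 (ν b) (x * √n) ∂(treeMeasure (fun j => ⌊α * j⌋₊) a)‖
            ≤ C * √n ^ (-(σ / 2)) := by
  let L : Bool → ℂ →L[ℝ] ℝ := fun c => bif c then Complex.reCLM else Complex.imCLM
  have hL : ∀ c z, |L c z| ≤ ‖z‖ := by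
    intro c z
    cases c
    · exact Complex.abs_im_le_norm z
    · exact Complex.abs_re_le_norm z
  let g : ℕ × Bool × Bool → ℝ → ℝ := fun i x => L i.2.2 (ft1 (ν i.2.1) (x * √(i.1 : ℝ)))
  have hcont : ∀ b (n : ℕ), Continuous fun x : ℝ => ft1 (ν b) (x * √n) := fun b n =>
    (continuous_ft1 (ν b)).comp (continuous_id.mul continuous_const)
  have hg : ∀ i, Continuous (g i) := fun i => (L i.2.2).continuous.comp (hcont _ _)
  set w : ℕ × Bool × Bool → ℝ := fun i => 1 / ((i.1 : ℝ) + 1) ^ 2 with hw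
  have hw0 : ∀ i, 0 < w i := fun i => by positivity
  have hws : Summable w := summable_weight
  have hm1 : ∀ j : ℕ, ((⌊α * j⌋₊ : ℕ) : ℝ) ≤ α * j := fun j => Nat.floor_le (by positivity)
  have hm2 : ∀ j : ℕ, α * j ≤ (⌊α * j⌋₊ : ℕ) + 1 := fun j => (Nat.lt_floor_add_one _).le
  have hstep : ∀ j : ℕ, ⌊α * (j + 1 : ℕ)⌋₊ = ⌊α * j⌋₊ ∨ ⌊α * (j + 1 : ℕ)⌋₊ = ⌊α * j⌋₊ + 1 := by
    intro j
    have h1 : ⌊α * j⌋₊ ≤ ⌊α * (j + 1 : ℕ)⌋₊ := Nat.floor_mono (by push_cast; nlinarith)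
    have h2 : ⌊α * (j + 1 : ℕ)⌋₊ ≤ ⌊α * j⌋₊ + 1 := by
      rw [← Nat.floor_add_one (by positivity)]
      exact Nat.floor_mono (by push_cast; nlinarith)
    omega
  obtain ⟨a, ha, hstepa⟩ := exists_dyadicTree w hw0 hws g hg (fun j => ⌊α * j⌋₊) (by simp) hstep
  refine ⟨a, ha, fun b s σ hs0 hs1 hdec hσ => ?_⟩
  have := ha.isProbabilityMeasure
  set μ := treeMeasure (fun j : ℕ => ⌊α * j⌋₊) a with hμ
  set W := ∑' i, w i with hW
  have hW0 : 0 < W := hws.tsum_pos (fun i => (hw0 i).le) (0, true, true) (hw0 _)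
  have hWi : ∀ i, w i ≤ W := fun i => hws.le_tsum i fun j _ => (hw0 j).le
  set δ := min α (s + α - σ) / 2 with hδ
  have hδ0 : 0 < δ := half_pos (lt_min hα0 (by linarith))
  have hδ1 : δ ≤ α / 2 := by
    have := min_le_left α (s + α - σ); linarith
  have hδ2 : δ ≤ (s + α - σ) / 2 := by
    have := min_le_right α (s + α - σ); linarith
  set θ := (α - δ) / 2 with hθ
  have hθ0 : 0 ≤ θ := by linarith
  have hθ1 : θ ≤ 1 / 2 := by linarith
  obtain ⟨C, hC0, hC⟩ := abs_cellAvg_ft1_le (hK b) (hK0 b) (hνK b) (continuous_ft1 (ν b)) hs0 hs1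
    hdec
  set q : ℝ := 2 ^ (θ - α / 2) with hq
  have hq1 : 0 < 1 - q :=
    sub_pos.2 (Real.rpow_lt_one_of_one_lt_of_neg one_lt_two (by linarith))
  set A : ℝ := (16 * W) ^ (δ / 2 / 4) / (δ / 2 / 4) with hA
  have hA0 : 0 ≤ A := by positivity
  have hmain : ∀ c (n : ℕ), 1 ≤ n →
      |∫ x, g (n, b, c) x ∂μ| ≤ C * (1 + 4 * A / (1 - q)) * √n ^ (-(σ / 2)) := by
    intro c n hn
    have hn' : (1 : ℝ) ≤ n := by exact_mod_cast hn
    have hξ : 1 ≤ √(n : ℝ) := Real.one_le_sqrt.2 hn'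
    set ξ := √(n : ℝ) with hξdef
    have hξ0 : 0 < ξ := by linarith
    have hlog0 : 0 ≤ Real.log (4 * W / w (n, b, c)) := by
      refine Real.log_nonneg ?_
      rw [one_le_div (hw0 _)]
      linarith [hWi (n, b, c)]
    have hlog : Real.log (4 * W / w (n, b, c)) ≤ A * ξ ^ (δ / 2) :=
      log_weight_le hW0 (half_pos hδ0) hn
    have h1 := abs_integral_treeMeasure_le (θ := θ) (by linarith) ha hm2 hθ1 (hg (n, b, c))
      (M := (ν b).real Set.univ) (fun x => (hL _ _).trans (norm_ft1_le _ _))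
      (P := C * ξ ^ (-(s / 2)) * ξ ^ (-θ)) (by positivity) hlog0
      (fun j p => hC (L c) (hL c) θ hθ0 (by linarith) ξ hξ j p)
      (fun j B hB => hstepa j (n, b, c) B hB)
    refine h1.trans ?_
    have hξδ : 1 ≤ ξ ^ (δ / 2) := Real.one_le_rpow hξ (by positivity)
    have h2 : 1 + 4 * Real.log (4 * W / w (n, b, c)) / (1 - q)
        ≤ ξ ^ (δ / 2) * (1 + 4 * A / (1 - q)) := by
      have : 4 * Real.log (4 * W / w (n, b, c)) / (1 - q) ≤ 4 * (A * ξ ^ (δ / 2)) / (1 - q) := by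
        gcongr
      calc _ ≤ ξ ^ (δ / 2) + 4 * (A * ξ ^ (δ / 2)) / (1 - q) := add_le_add hξδ this
        _ = _ := by ring
    calc C * ξ ^ (-(s / 2)) * ξ ^ (-θ) * (1 + 4 * Real.log (4 * W / w (n, b, c)) / (1 - q))
        ≤ C * ξ ^ (-(s / 2)) * ξ ^ (-θ) * (ξ ^ (δ / 2) * (1 + 4 * A / (1 - q))) := by gcongr
      _ = C * (1 + 4 * A / (1 - q)) * (ξ ^ (-(s / 2)) * ξ ^ (-θ) * ξ ^ (δ / 2)) := by ring
      _ ≤ _ := by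
        have : 0 ≤ 4 * A / (1 - q) := by positivity
        rw [← Real.rpow_add hξ0, ← Real.rpow_add hξ0]
        refine mul_le_mul_of_nonneg_left ?_ (by positivity)
        exact Real.rpow_le_rpow_of_exponent_le hξ (by linarith)
  have hnn : 0 ≤ C * (1 + 4 * A / (1 - q)) := by positivity
  refine ⟨2 * (C * (1 + 4 * A / (1 - q))), by positivity, fun n hn => ?_⟩
  have hint : Integrable (fun x => ft1 (ν b) (x * √n)) μ :=
    Integrable.mono' (integrable_const ((ν b).real Set.univ)) (hcont b n).aestronglyMeasurable
      (Filter.Eventually.of_forall fun x => norm_ft1_le _ _)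
  have hcomm : ∀ c, ∫ x, g (n, b, c) x ∂μ = L c (∫ x, ft1 (ν b) (x * √n) ∂μ) := fun c =>
    (L c).integral_comp_comm hint
  have hre := hmain true n hn
  have him := hmain false n hn
  rw [hcomm] at hre him
  refine (Complex.norm_le_abs_re_add_abs_im _).trans ?_
  refine (add_le_add hre him).trans (le_of_eq ?_)
  ring

lemma bddAbove_fDim_set (ρ : Measure ℝ) :
    BddAbove {s : ℝ | 0 ≤ s ∧ s ≤ 1 ∧ ∃ C : ℝ, ∀ ξ, ‖ft1 ρ ξ‖ ^ 2 * |ξ| ^ s ≤ C} :=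
  ⟨1, fun _ hs => hs.2.1⟩

lemma zero_mem_fDim_set (ρ : Measure ℝ) [IsFiniteMeasure ρ] :
    (0 : ℝ) ∈ {s : ℝ | 0 ≤ s ∧ s ≤ 1 ∧ ∃ C : ℝ, ∀ ξ, ‖ft1 ρ ξ‖ ^ 2 * |ξ| ^ s ≤ C} := by
  refine ⟨le_rfl, zero_le_one, ρ.real Set.univ ^ 2, fun ξ => ?_⟩
  rw [Real.rpow_zero, mul_one]
  have := norm_ft1_le ρ ξ
  gcongr

lemma fDimM1_nonneg (ρ : Measure ℝ) [IsFiniteMeasure ρ] : 0 ≤ fDimM1 ρ :=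
  le_csSup (bddAbove_fDim_set ρ) (zero_mem_fDim_set ρ)

instance isFiniteMeasure_mulConv1 (μ ν : Measure ℝ) [IsFiniteMeasure μ] [IsFiniteMeasure ν] :
    IsFiniteMeasure (mulConv1 μ ν) := by
  unfold mulConv1; infer_instance

lemma mulConv1_dirac_one_left (ν : Measure ℝ) [IsFiniteMeasure ν] :
    mulConv1 (Measure.dirac 1) ν = ν := by
  rw [mulConv1, Measure.dirac_prod, Measure.map_map (by fun_prop) (by fun_prop)]
  simp [Function.comp_def]

lemma mulConv1_dirac_one_right (μ : Measure ℝ) [IsFiniteMeasure μ] :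
    mulConv1 μ (Measure.dirac 1) = μ := by
  rw [mulConv1, Measure.prod_dirac, Measure.map_map (by fun_prop) (by fun_prop)]
  simp [Function.comp_def]

lemma ae_mulConv1_abs_le {μ ν : Measure ℝ} [IsFiniteMeasure μ] [IsFiniteMeasure ν] {R S : ℝ}
    (hμ : ∀ᵐ x ∂μ, |x| ≤ R) (hν : ∀ᵐ x ∂ν, |x| ≤ S) : ∀ᵐ x ∂(mulConv1 μ ν), |x| ≤ R * S := by
  have hms : MeasurableSet {x : ℝ | |x| ≤ R * S} := measurableSet_le (by fun_prop) (by fun_prop)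
  rw [mulConv1, ae_map_iff (by fun_prop) hms]
  have h1 := Measure.quasiMeasurePreserving_fst (μ := μ) (ν := ν) |>.ae hμ
  have h2 := Measure.quasiMeasurePreserving_snd (μ := μ) (ν := ν) |>.ae hν
  filter_upwards [h1, h2] with z hz1 hz2
  rw [abs_mul]
  exact mul_le_mul hz1 hz2 (abs_nonneg _) ((abs_nonneg _).trans hz1)

lemma min_add_fDimM1_le {α : ℝ} {μ ν : Measure ℝ} [IsProbabilityMeasure μ]
    [IsFiniteMeasure ν] (hμ : ∀ᵐ x ∂μ, x ∈ Set.Icc (1 : ℝ) 2) {K : Set ℝ} (hK : IsCompact K)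
    (hνK : ν Kᶜ = 0)
    (H : ∀ s σ, 0 ≤ s → s ≤ 1 → (∃ C : ℝ, ∀ ξ, ‖ft1 ν ξ‖ ^ 2 * |ξ| ^ s ≤ C) →
        σ < s + α → ∃ C : ℝ, 0 ≤ C ∧ ∀ n : ℕ, 1 ≤ n →
          ‖∫ x, ft1 ν (x * √n) ∂μ‖ ≤ C * √n ^ (-(σ / 2))) :
    min 1 (α + fDimM1 ν) ≤ fDimM1 (mulConv1 μ ν) := by
  refine le_of_forall_lt_imp_le_of_dense fun σ hσ => ?_
  obtain ⟨hσ1, hσ2⟩ := lt_min_iff.1 hσ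
  rcases lt_or_ge σ 0 with hσ0 | hσ0
  · exact hσ0.le.trans (fDimM1_nonneg _)
  obtain ⟨s, ⟨hs0, hs1, hs⟩, hlt⟩ := exists_lt_of_lt_csSup ⟨0, zero_mem_fDim_set ν⟩
    (show σ - α < fDimM1 ν by linarith)
  obtain ⟨C, hC0, hC⟩ := H s σ hs0 hs1 hs (by linarith)
  obtain ⟨S, hS⟩ := hK.isBounded.subset_closedBall 0
  have hμ2 : ∀ᵐ x ∂μ, |x| ≤ 2 := by
    filter_upwards [hμ] with x hx
    exact abs_le.2 ⟨by linarith [hx.1], hx.2⟩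
  have hνS : ∀ᵐ x ∂ν, |x| ≤ |S| := by
    have hae : ∀ᵐ x ∂ν, x ∈ K := hνK
    filter_upwards [hae] with x hx
    exact (mem_closedBall_zero_iff.1 (hS hx)).trans (le_abs_self S)
  refine le_csSup (bddAbove_fDim_set _) ⟨hσ0, hσ1.le, ?_⟩
  refine exists_decay_of_sqrt (by positivity) (ae_mulConv1_abs_le hμ2 hνS) hσ0 hσ1.le hC0
    fun n hn => ?_
  rw [ft1_mulConv1]
  exact hC n hn

lemma measurableSet_le_measure_closedBall (μ : Measure ℝ) [IsFiniteMeasure μ] (c : ℝ≥0∞) (r : ℝ) :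
    MeasurableSet {x | c ≤ μ (Metric.closedBall x r)} := by
  have hs : MeasurableSet {p : ℝ × ℝ | dist p.2 p.1 ≤ r} :=
    measurableSet_le (by fun_prop) (by fun_prop)
  exact measurableSet_le measurable_const (measurable_measure_prodMk_left hs)

lemma hDimM_dirac (x : ℝ) : hDimM (Measure.dirac x) = 0 := by
  refine le_antisymm ?_ zero_le
  refine (iInf₂_le {x} (measurableSet_singleton x)).trans ((iInf_le _ (by simp)).trans ?_)
  rw [dimH_singleton]

lemma ft1_dirac (x ξ : ℝ) :
    ft1 (Measure.dirac x) ξ = Complex.exp (((-2 * Real.pi * x * ξ : ℝ) : ℂ) * Complex.I) := by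
  rw [ft1, integral_dirac]

lemma fDimM1_dirac (x : ℝ) : fDimM1 (Measure.dirac x) = 0 := by
  refine le_antisymm (csSup_le ⟨0, zero_mem_fDim_set _⟩ ?_) (fDimM1_nonneg _)
  rintro s ⟨hs0, -, C, hC⟩
  by_contra! hs
  have ht := (tendsto_rpow_atTop hs).eventually_gt_atTop C
  obtain ⟨ξ, h1, h2⟩ := (ht.and (Filter.eventually_ge_atTop 0)).exists
  have h3 := hC ξ
  rw [ft1_dirac, norm_exp_ofReal_mul_I_integrand, abs_of_nonneg h2] at h3
  linarith

end Main

theorem stmt18 (α : ℝ) (hα0 : 0 ≤ α) (hα1 : α ≤ 1)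
    (ν : Measure ℝ) (hν0 : ν ≠ 0) [IsFiniteMeasure ν]
    (hνsupp : ∃ K : Set ℝ, IsCompact K ∧ (0 : ℝ) ∉ K ∧ ν Kᶜ = 0) :
    ∃ μ : Measure ℝ, IsProbabilityMeasure μ ∧ μ (Set.Icc (1 : ℝ) 2)ᶜ = 0 ∧
      hDimM μ = ENNReal.ofReal α ∧ fDimM1 μ = α ∧
      min 1 (fDimM1 μ + fDimM1 ν) ≤ fDimM1 (mulConv1 μ ν) := by
  obtain ⟨K, hK, hK0, hνK⟩ := hνsupp
  rcases hα0.eq_or_lt with rfl | hα0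
  · refine ⟨Measure.dirac 1, inferInstance, ?_, ?_, fDimM1_dirac 1, ?_⟩
    · simp [measurableSet_Icc.compl]
    · rw [hDimM_dirac, ENNReal.ofReal_zero]
    · rw [mulConv1_dirac_one_left, fDimM1_dirac, zero_add]
      exact min_le_right _ _
  have : ∀ b, IsFiniteMeasure ((fun b : Bool => bif b then ν else Measure.dirac 1) b) := by
    intro b
    cases b <;> (simp only [cond_true, cond_false]; infer_instance)
  obtain ⟨a, ha, H⟩ := exists_dyadicTree_decay hα0 hα1
    (fun b => bif b then ν else Measure.dirac 1) (fun b => bif b then K else {1})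
    (by rintro (_ | _); exacts [isCompact_singleton, hK])
    (by rintro (_ | _); exacts [by simp, hK0])
    (by rintro (_ | _); exacts [by simp, hνK])
  have hm1 : ∀ j : ℕ, ((⌊α * j⌋₊ : ℕ) : ℝ) ≤ α * j := fun j => Nat.floor_le (by positivity)
  have hm2 : ∀ j : ℕ, α * j ≤ (⌊α * j⌋₊ : ℕ) + 1 := fun j => (Nat.lt_floor_add_one _).le
  have hprob := ha.isProbabilityMeasure
  have hIcc := ha.ae_mem_Icc
  have hH : hDimM (treeMeasure (fun j : ℕ => ⌊α * j⌋₊) a) = ENNReal.ofReal α :=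
    ha.hDimM_eq hα0 hm1 hm2
  have hF1 : fDimM1 (treeMeasure (fun j : ℕ => ⌊α * j⌋₊) a) ≤ α := by
    refine fDimM1_le_of_le_measure_closedBall hα0.le fun j => ?_
    refine ha.ae_of_forall (measurableSet_le_measure_closedBall _ _ _) fun u hu => ?_
    exact (ENNReal.ofReal_le_ofReal (rpow_le_one_div_two_pow (hm1 j))).trans
      (ha.le_measure_closedBall j hu)
  have hF2 := min_add_fDimM1_le hIcc isCompact_singleton (ν := Measure.dirac (1 : ℝ))
    (K := {1}) (by simp) (H false)
  rw [mulConv1_dirac_one_right, fDimM1_dirac, add_zero, min_eq_right hα1] at hF2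
  have hF := le_antisymm hF1 hF2
  refine ⟨_, hprob, ?_, hH, hF, ?_⟩
  · exact hIcc
  · rw [hF]
    exact min_add_fDimM1_le hIcc hK hνK (H true)
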